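/- arXiv:1410.5701 — 3 statements merged into one kernel-verified Lean document; each statement's English description precedes it below -/
import Mathlib

section
/- Let γ : [0,1] → ℂ be a continuous injective curve with γ(0) ∈ ℝ and γ(t) ∈ ℍ for all t ∈ (0,1], and let K = γ((0,1]) (a half-plane hull which is a simple curve meeting ℝ in exactly one point). Suppose ℍ \ K is a (β,C₀)-Hölder domain. Then diam(K) ≤ C·√( hcap(K)·(1 + log⁺(1/diam(K))) ), where C > 0 depends only on β and C₀. -/
open Set Metric Filter Bornology Complex Function

noncomputable section

/-- The upper half-plane as a subset of `ℂ`. -/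
def UHP : Set ℂ := {z : ℂ | 0 < z.im}

/-- `K` is a half-plane hull: a bounded subset of the upper half-plane whose
complement in the upper half-plane is a simply connected domain. -/
def IsHull (K : Set ℂ) : Prop :=
  IsBounded K ∧ K ⊆ UHP ∧ IsOpen (UHP \ K) ∧ IsConnected (UHP \ K) ∧
    SimplyConnectedSpace ↥(UHP \ K)

/-- `f` is the hydrodynamic conformal map of the hull `K`: a conformal bijection
from the upper half-plane onto `UHP \ K` with `f z - z → 0` as `|z| → ∞` in `UHP`. -/
def IsHydroMap (K : Set ℂ) (f : ℂ → ℂ) : Prop :=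
  DifferentiableOn ℂ f UHP ∧ InjOn f UHP ∧ f '' UHP = UHP \ K ∧
    Tendsto (fun z => f z - z) (cobounded ℂ ⊓ 𝓟 UHP) (nhds (0 : ℂ))

/-- `f` is the hydrodynamic map of `K` and `g` is its inverse. -/
def IsHydroPair (K : Set ℂ) (f g : ℂ → ℂ) : Prop :=
  IsHydroMap K f ∧ InvOn g f UHP (UHP \ K)

/-- `K` has half-plane capacity `a`, computed via its hydrodynamic map `f`:
`z * (z - f z) → a` as `|z| → ∞` in `UHP`. -/
def HasHcap (K : Set ℂ) (f : ℂ → ℂ) (a : ℝ) : Prop :=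
  Tendsto (fun z => z * (z - f z)) (cobounded ℂ ⊓ 𝓟 UHP) (nhds (a : ℂ))

/-- The `(β, C₀)`-Hölder condition for a map defined on the upper half-plane. -/
def IsHolder (f : ℂ → ℂ) (β C₀ : ℝ) : Prop :=
  ∀ z ∈ UHP, ∀ z' ∈ UHP, dist (f z) (f z') ≤ C₀ * max (dist z z' ^ β) (dist z z')

/-- The Poincaré hyperbolic distance on the upper half-plane. -/
def rhoH (z w : ℂ) : ℝ :=
  2 * Real.arsinh (dist z w / (2 * Real.sqrt (z.im * w.im)))

/-- The hyperbolic distance on a simply connected domain `Ω`, transported through a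
conformal bijection `φ : UHP → Ω` (independent of the choice of `φ`). -/
def rhoVia (φ : ℂ → ℂ) (z w : ℂ) : ℝ :=
  rhoH (invFunOn φ UHP z) (invFunOn φ UHP w)

/-- `log⁺ x = max (log x) 0`. -/
def posLog (x : ℝ) : ℝ := max (Real.log x) 0

/-- Internal distance between `A` and `B` inside `Ω`: the infimum of diameters of
connected subsets of `Ω` meeting both `A` and `B`. -/
def distIn (Ω A B : Set ℂ) : ℝ :=
  sInf {d : ℝ | ∃ E : Set ℂ, E ⊆ Ω ∧ IsConnected E ∧ (E ∩ A).Nonempty ∧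
    (E ∩ B).Nonempty ∧ d = Metric.diam E}

/-- Internal diameter of `A` inside `Ω`. -/
def diamIn (Ω A : Set ℂ) : ℝ :=
  sSup {d : ℝ | ∃ a ∈ A, ∃ b ∈ A, d = distIn Ω {a} {b}}

/-- An `L`-John curve in `Ω` with tip `z`, parametrized on `[0,1)` (the base-point,
which is not required to lie in `Ω`, corresponds to the missing endpoint). -/
def IsJohnCurve (Ω : Set ℂ) (L : ℝ) (α : ℝ → ℂ) (z : ℂ) : Prop :=
  ContinuousOn α (Ico 0 1) ∧ InjOn α (Ico 0 1) ∧ α 0 = z ∧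
    MapsTo α (Ico 0 1) Ω ∧
    ∀ t ∈ Ico (0:ℝ) 1, Metric.diam (α '' Icc 0 t) ≤ L * infDist (α t) (frontier Ω)

/-- An `L`-John curve in `Ω` with tip `z` and base-point `∞`, parametrized on `[0,∞)`. -/
def IsJohnCurveInfty (Ω : Set ℂ) (L : ℝ) (α : ℝ → ℂ) (z : ℂ) : Prop :=
  ContinuousOn α (Ici 0) ∧ InjOn α (Ici 0) ∧ α 0 = z ∧
    MapsTo α (Ici 0) Ω ∧ Tendsto α atTop (cobounded ℂ) ∧
    ∀ t ∈ Ici (0:ℝ), Metric.diam (α '' Icc 0 t) ≤ L * infDist (α t) (frontier Ω)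

/-- Working hypotheses on a hull complement and its conformal parametrization. -/
structure Hyd (K : Set ℂ) (f g : ℂ → ℂ) : Prop where
  hKU : K ⊆ UHP
  hopen : IsOpen (UHP \ K)
  fd : DifferentiableOn ℂ f UHP
  finj : InjOn f UHP
  fim : f '' UHP = UHP \ K
  flim : Tendsto (fun z => f z - z) (cobounded ℂ ⊓ 𝓟 UHP) (nhds (0 : ℂ))
  gdef : g = invFunOn f UHP

lemma isOpen_UHP : IsOpen UHP := isOpen_lt continuous_const Complex.continuous_im

lemma mem_UHP {z : ℂ} : z ∈ UHP ↔ 0 < z.im := Iff.rfl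

lemma convex_UHP : Convex ℝ UHP := convex_halfSpace_im_gt 0

namespace Hyd
variable {K : Set ℂ} {f g : ℂ → ℂ}

lemma gf (h : Hyd K f g) {w : ℂ} (hw : w ∈ UHP) : g (f w) = w := by
  rw [h.gdef]; exact h.finj.leftInvOn_invFunOn hw

lemma f_mem (h : Hyd K f g) {w : ℂ} (hw : w ∈ UHP) : f w ∈ UHP \ K := by
  rw [← h.fim]; exact mem_image_of_mem _ hw

lemma g_mem (h : Hyd K f g) {z : ℂ} (hz : z ∈ UHP \ K) : g z ∈ UHP := by
  rw [← h.fim] at hz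
  obtain ⟨w, hw, rfl⟩ := hz
  rwa [h.gf hw]

lemma fg (h : Hyd K f g) {z : ℂ} (hz : z ∈ UHP \ K) : f (g z) = z := by
  rw [← h.fim] at hz
  obtain ⟨w, hw, rfl⟩ := hz
  rw [h.gf hw]

lemma fan (h : Hyd K f g) {w : ℂ} (hw : w ∈ UHP) : AnalyticAt ℂ f w :=
  h.fd.analyticAt (isOpen_UHP.mem_nhds hw)

lemma nhds_le (h : Hyd K f g) {w : ℂ} (hw : w ∈ UHP) : nhds (f w) ≤ map f (nhds w) := by
  rcases (h.fan hw).eventually_constant_or_nhds_le_map_nhds with hc | hc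
  · exfalso
    have h2 : ∀ᶠ z in nhds w, z = w := by
      filter_upwards [hc, isOpen_UHP.mem_nhds hw] with z hz hzU
      exact h.finj hzU hw hz
    have : ({w} : Set ℂ) ∈ nhds w := h2
    obtain ⟨r, hr, hrs⟩ := Metric.mem_nhds_iff.1 this
    have hw2 : w + (r/2 : ℝ) ∈ ball w r := by simp [abs_of_pos hr, hr]
    have h3 : w + (r/2 : ℝ) = w := hrs hw2
    have : (r/2 : ℝ) = (0:ℂ) := by linear_combination h3
    norm_cast at this
    linarith
  · exact hc

lemma g_cont (h : Hyd K f g) {z : ℂ} (hz : z ∈ UHP \ K) : ContinuousAt g z := by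
  have hw := h.g_mem hz
  have h1 := h.nhds_le hw
  rw [h.fg hz] at h1
  intro s hs
  have : f '' (s ∩ UHP) ∈ nhds z := h1 (image_mem_map (inter_mem hs (isOpen_UHP.mem_nhds hw)))
  show ∀ᶠ y in nhds z, g y ∈ s
  filter_upwards [this]
  rintro _ ⟨w, ⟨hws, hwU⟩, rfl⟩
  simpa [h.gf hwU] using hws

lemma g_diff_of (h : Hyd K f g) {w : ℂ} (hw : w ∈ UHP) (hd : deriv f w ≠ 0) :
    HasDerivAt g (deriv f w)⁻¹ (f w) := by
  have hz := h.f_mem hw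
  have := HasDerivAt.of_local_left_inverse (f := f) (g := g) (a := f w) (f' := deriv f w)
    (h.g_cont hz) (by rw [h.gf hw]; exact (h.fan hw).differentiableAt.hasDerivAt) hd
    (by filter_upwards [h.hopen.mem_nhds hz] with y hy using h.fg hy)
  exact this

lemma g_diff (h : Hyd K f g) {z : ℂ} (hz : z ∈ UHP \ K) : DifferentiableAt ℂ g z := by
  set w := g z with hwd
  have hw : w ∈ UHP := h.g_mem hz
  have hfw : f w = z := h.fg hz
  have han : AnalyticAt ℂ (deriv f) w := (h.fan hw).deriv
  rcases han.eventually_eq_zero_or_eventually_ne_zero with h0 | h0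
  · exfalso
    obtain ⟨r, hr, hrs⟩ := Metric.eventually_nhds_iff_ball.1 (h0.and (isOpen_UHP.mem_nhds hw))
    have hw2 : w + (r/2 : ℝ) ∈ ball w r := by
      simp [abs_of_pos hr, hr]
    have := (convex_ball w r).is_const_of_fderivWithin_eq_zero (𝕜 := ℂ) (f := f)
      (fun y hy => (h.fan (hrs y hy).2).differentiableAt.differentiableWithinAt)
      (fun y hy => by
        rw [fderivWithin_of_isOpen isOpen_ball hy]
        ext; simp [(hrs y hy).1]) (mem_ball_self hr) hw2
    have h3 := h.finj hw (hrs _ hw2).2 this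
    have : (r/2 : ℝ) = (0:ℂ) := by linear_combination -h3
    norm_cast at this
    linarith
  · have h1 : ∀ᶠ y in nhdsWithin z {z}ᶜ, DifferentiableAt ℂ g y := by
      have h2 : Tendsto g (nhdsWithin z {z}ᶜ) (nhdsWithin w {w}ᶜ) := by
        refine tendsto_nhdsWithin_iff.2 ⟨(h.g_cont hz).tendsto.mono_left nhdsWithin_le_nhds, ?_⟩
        filter_upwards [self_mem_nhdsWithin, nhdsWithin_le_nhds (h.hopen.mem_nhds hz)] with y hy hyU hh
        apply hy
        have : g y = w := hh
        rw [← h.fg hyU, this, hfw]; rfl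
      filter_upwards [h2.eventually h0, nhdsWithin_le_nhds (h.hopen.mem_nhds hz)] with y hy hyU
      have := h.g_diff_of (h.g_mem hyU) hy
      rw [h.fg hyU] at this
      exact this.differentiableAt
    exact (analyticAt_of_differentiable_on_punctured_nhds_of_continuousAt h1 (h.g_cont hz)).differentiableAt

lemma g_diffOn (h : Hyd K f g) : DifferentiableOn ℂ g (UHP \ K) :=
  fun _ hz => (h.g_diff hz).differentiableWithinAt

lemma deriv_mul (h : Hyd K f g) {w : ℂ} (hw : w ∈ UHP) : deriv g (f w) * deriv f w = 1 := by
  have h1 : HasDerivAt (g ∘ f) (deriv g (f w) * deriv f w) w :=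
    (h.g_diff (h.f_mem hw)).hasDerivAt.comp w (h.fan hw).differentiableAt.hasDerivAt
  have h2 : HasDerivAt (g ∘ f) 1 w := by
    refine (hasDerivAt_id w).congr_of_eventuallyEq ?_
    filter_upwards [isOpen_UHP.mem_nhds hw] with y hy using h.gf hy
  exact h1.unique h2

/-- `Im f(w) ≥ Im w`. -/
lemma im_le (h : Hyd K f g) {w : ℂ} (hw : w ∈ UHP) : w.im ≤ (f w).im := by
  refine le_of_forall_pos_le_add fun ε0 hε0 => ?_
  obtain ⟨ε, hε, hεε, hεw⟩ : ∃ ε > 0, ε ≤ ε0 ∧ ε < w.im :=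
    ⟨min ε0 (w.im/2), lt_min hε0 (half_pos hw), min_le_left _ _,
      (min_le_right _ _).trans_lt (half_lt_self hw)⟩
  have h1 := h.flim.eventually (Metric.ball_mem_nhds 0 hε)
  rw [eventually_inf_principal, ← comap_norm_atTop, eventually_comap] at h1
  obtain ⟨R, hR⟩ := ((h1.and (eventually_gt_atTop ‖w‖)).exists_forall_of_atTop)
  have hRR := (hR R le_rfl).2
  set U : Set ℂ := ball 0 R ∩ {z | ε < z.im} with hU
  have hcl : closure U ⊆ closedBall 0 R ∩ {z | ε ≤ z.im} := by
    refine closure_minimal ?_ (isClosed_closedBall.inter (isClosed_le continuous_const continuous_im))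
    exact fun z hz => ⟨ball_subset_closedBall hz.1, (show ε ≤ z.im from le_of_lt hz.2)⟩
  have hUo : IsOpen U := isOpen_ball.inter (isOpen_lt continuous_const continuous_im)
  have hsub : closure U ⊆ UHP := fun z hz => hε.trans_le (hcl hz).2
  have hd : DiffContOnCl ℂ (fun z => Complex.exp (I * (f z - z))) U := by
    apply DifferentiableOn.diffContOnCl
    intro z hz
    have := (h.fan (hsub hz)).differentiableAt
    exact (by fun_prop : DifferentiableAt ℂ (fun z => Complex.exp (I * (f z - z))) z).differentiableWithinAt
  have hn : ∀ z, ‖Complex.exp (I * (f z - z))‖ = Real.exp (z.im - (f z).im) := by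
    intro z; rw [Complex.norm_exp]; simp
  have key := Complex.norm_le_of_forall_mem_frontier_norm_le (isBounded_ball.subset inter_subset_left) hd
    (C := Real.exp ε) (fun z hz => by
      rw [hn, Real.exp_le_exp]
      have hzc := hcl (frontier_subset_closure hz)
      have hzU : z ∈ UHP := hsub (frontier_subset_closure hz)
      have hznU : z ∉ U := by rw [frontier, hUo.interior_eq] at hz; exact hz.2
      by_cases hz2 : ε < z.im
      · have hzR : ‖z‖ = R := by
          have h3 := hzc.1
          rw [mem_closedBall_zero_iff] at h3
          by_contra hne
          exact hznU ⟨by simpa using lt_of_le_of_ne h3 hne, hz2⟩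
        have := (hR R le_rfl).1 z hzR hzU
        rw [dist_zero_right] at this
        have h4 := (abs_im_le_norm (f z - z)).trans this.le
        rw [sub_im, abs_le] at h4
        linarith [h4.1]
      · have := (h.f_mem hzU).1
        have h5 : 0 < (f z).im := this
        push Not at hz2
        linarith) (z := w) (subset_closure ⟨by simpa using hRR, hεw⟩)
  rw [hn, Real.exp_le_exp] at key
  linarith

lemma g_im_le (h : Hyd K f g) {z : ℂ} (hz : z ∈ UHP \ K) : (g z).im ≤ z.im := by
  have := h.im_le (h.g_mem hz)
  rwa [h.fg hz] at this

/-- Schwarz-Pick type derivative bound. -/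
lemma deriv_le (h : Hyd K f g) {z : ℂ} {r : ℝ} (hr : 0 < r) (hb : ball z r ⊆ UHP \ K) :
    ‖deriv g z‖ ≤ 2 * z.im / r := by
  have hz : z ∈ UHP \ K := hb (mem_ball_self hr)
  set c := g z with hc
  have hcU : 0 < c.im := h.g_mem hz
  have hne : ∀ y ∈ ball z r, g y - (starRingEnd ℂ) c ≠ 0 := by
    intro y hy h0
    have h1 : 0 < (g y).im := h.g_mem (hb hy)
    have := congrArg Complex.im h0
    simp at this
    linarith
  have hlt : ∀ y ∈ ball z r, ‖(g y - c) / (g y - (starRingEnd ℂ) c)‖ < 1 := by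
    intro y hy
    rw [norm_div, div_lt_one (norm_pos_iff.2 (hne y hy))]
    have h1 : 0 < (g y).im := h.g_mem (hb hy)
    rw [← sq_lt_sq₀ (norm_nonneg _) (norm_nonneg _), ← normSq_eq_norm_sq, ← normSq_eq_norm_sq,
      normSq_apply, normSq_apply]
    simp
    nlinarith [mul_pos h1 hcU]
  have hd : DifferentiableOn ℂ (fun y => (g y - c) / (g y - (starRingEnd ℂ) c)) (ball z r) := by
    intro y hy
    have h1 := h.g_diff (hb hy)
    have h2 := hne y hy
    exact ((h1.sub_const _).fun_div (h1.sub_const _) h2).differentiableWithinAt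
  have key := Complex.norm_deriv_le_div_of_mapsTo_ball (R₂ := 1) hd
    (fun y hy => by
      rw [← hc, sub_self, zero_div]
      simpa using (hlt y hy).le) hr
  have hder : deriv (fun y => (g y - c) / (g y - (starRingEnd ℂ) c)) z
      = deriv g z / (c - (starRingEnd ℂ) c) := by
    have h1 := (h.g_diff hz).hasDerivAt
    have h2 := (h1.sub_const c).div (h1.sub_const ((starRingEnd ℂ) c)) (hne z (mem_ball_self hr))
    refine h2.deriv.trans ?_
    have h3 := hne z (mem_ball_self hr)
    rw [← hc] at h3 ⊢
    field_simp
    ring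
  rw [hder, norm_div, sub_conj, norm_mul, norm_I, mul_one, norm_real, Real.norm_eq_abs,
    abs_of_pos (by linarith), div_le_iff₀ (by linarith)] at key
  refine key.trans ?_
  rw [div_mul_eq_mul_div, one_mul]
  gcongr
  exact h.g_im_le hz

end Hyd

namespace Hyd
variable {K : Set ℂ} {f g : ℂ → ℂ}

lemma exists_far (h : Hyd K f g) {ε : ℝ} (hε : 0 < ε) :
    ∃ R > 0, ∀ w ∈ UHP, R ≤ ‖w‖ → ‖f w - w‖ < ε := by
  have h1 := h.flim.eventually (Metric.ball_mem_nhds 0 hε)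
  rw [eventually_inf_principal, ← comap_norm_atTop, eventually_comap] at h1
  obtain ⟨R, hR⟩ := ((h1.and (eventually_gt_atTop 0)).exists_forall_of_atTop)
  refine ⟨R, (hR R le_rfl).2, fun w hw hRw => ?_⟩
  simpa using (hR _ hRw).1 w rfl hw

lemma circle_lip (h : Hyd K f g) {x₀ ρ : ℝ} (hρ : 0 < ρ) (hK : K ⊆ closedBall (x₀ : ℂ) ρ) :
    ∀ θ ∈ Ioo 0 Real.pi, ∀ θ' ∈ Ioo 0 Real.pi,
      ‖g (x₀ + (2 * ρ : ℝ) * exp (θ * I)) - g (x₀ + (2 * ρ : ℝ) * exp (θ' * I))‖ ≤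
        8 * ρ * ‖θ - θ'‖ := by
  have hmem : ∀ θ ∈ Ioo 0 Real.pi, ∀ y ∈ ball ((x₀:ℂ) + (2 * ρ : ℝ) * exp (θ * I))
      (min (2 * ρ * Real.sin θ) ρ), y ∈ UHP \ K := by
    intro θ hθ y hy
    have hs := Real.sin_pos_of_mem_Ioo hθ
    rw [mem_ball, dist_eq_norm, lt_min_iff] at hy
    constructor
    · have h1 := (abs_im_le_norm _).trans_lt hy.1
      rw [abs_lt] at h1
      simp [exp_im, exp_re] at h1
      show 0 < y.im
      linarith [h1.1]
    · intro hyK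
      have h2 := hK hyK
      rw [mem_closedBall, dist_eq_norm] at h2
      have h3 : ‖((2 * ρ : ℝ) : ℂ) * exp (θ * I)‖ = 2 * ρ := by
        rw [norm_mul, norm_exp_ofReal_mul_I, norm_real, Real.norm_eq_abs, abs_of_pos (by linarith), mul_one]
      have h4 : ‖((2 * ρ : ℝ) : ℂ) * exp (θ * I)‖ ≤ ‖y - x₀‖ + ‖y - (x₀ + (2 * ρ : ℝ) * exp (θ * I))‖ := by
        have := norm_sub_le (y - x₀) (y - (x₀ + (2 * ρ : ℝ) * exp (θ * I)))
        refine le_trans (le_of_eq ?_) this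
        congr 1; ring
      linarith [hy.2]
  intro θ hθ θ' hθ'
  have hder : ∀ θ ∈ Ioo 0 Real.pi, HasDerivWithinAt (fun θ : ℝ => g (x₀ + (2 * ρ : ℝ) * exp (θ * I)))
      (deriv g (x₀ + (2 * ρ : ℝ) * exp (θ * I)) * ((2 * ρ : ℝ) * (exp (θ * I) * I))) (Ioo 0 Real.pi) θ := by
    intro θ hθ
    have hs := Real.sin_pos_of_mem_Ioo hθ
    have h1 := (h.g_diff (hmem θ hθ _ (mem_ball_self (lt_min (by positivity) hρ)))).hasDerivAt
    have h2 : HasDerivAt (fun θ : ℝ => (x₀ : ℂ) + (2 * ρ : ℝ) * exp (θ * I))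
        ((2 * ρ : ℝ) * (exp (θ * I) * I)) θ := by
      have h3 : HasDerivAt (fun θ : ℝ => (θ : ℂ) * I) I θ := by
        simpa using (Complex.ofRealCLM.hasDerivAt (x := θ)).mul_const I
      exact (h3.cexp.const_mul _).const_add _
    exact (h1.comp θ h2).hasDerivWithinAt
  refine (convex_Ioo 0 Real.pi).norm_image_sub_le_of_norm_hasDerivWithin_le hder (C := 8 * ρ) ?_ hθ' hθ
  intro θ hθ
  have hs := Real.sin_pos_of_mem_Ioo hθ
  have h1 := h.deriv_le (lt_min (by positivity) hρ) (hmem θ hθ)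
  rw [norm_mul, norm_mul, norm_mul, norm_exp_ofReal_mul_I, norm_real, Real.norm_eq_abs,
    abs_of_pos (by linarith), norm_I]
  have h2 : (x₀ + (2 * ρ : ℝ) * exp (θ * I) : ℂ).im = 2 * ρ * Real.sin θ := by
    simp [exp_im, exp_re]
  rw [h2] at h1
  have h3 : 2 * (2 * ρ * Real.sin θ) / min (2 * ρ * Real.sin θ) ρ ≤ 4 := by
    rw [div_le_iff₀ (lt_min (by positivity) hρ)]
    rcases min_cases (2 * ρ * Real.sin θ) ρ with ⟨h5, h6⟩ | ⟨h5, h6⟩ <;> rw [h5]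
    · nlinarith [mul_pos hρ hs]
    · nlinarith [Real.sin_le_one θ]
  nlinarith [norm_nonneg (deriv g (x₀ + (2 * ρ : ℝ) * exp (θ * I)))]

lemma R_bound (h : Hyd K f g) {x₀ ρ : ℝ} (hρ : 0 < ρ) (hK : K ⊆ closedBall (x₀ : ℂ) ρ) :
    ∃ c : ℝ, ∀ w ∈ UHP, ‖f w - x₀‖ < 2 * ρ → ‖w - c‖ ≤ 28 * ρ := by
  set c := g (x₀ + (2 * ρ : ℝ) * exp ((Real.pi / 2 : ℝ) * I)) with hc
  have hpi := Real.pi_pos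
  have hpi2 := Real.pi_lt_d2
  have hlip := h.circle_lip hρ hK
  have hz0 : (x₀ + (2 * ρ : ℝ) * exp ((Real.pi / 2 : ℝ) * I) : ℂ) ∈ UHP \ K := by
    have e : (exp ((Real.pi / 2 : ℝ) * I) : ℂ) = I := by push_cast; exact exp_pi_div_two_mul_I
    rw [e]
    constructor
    · rw [mem_UHP]; simp [hρ]
    · intro hh
      have := hK hh
      simp [abs_of_pos hρ] at this
      linarith
  have hcim : c.im ≤ 2 * ρ := by
    have := h.g_im_le hz0
    refine this.trans ?_
    simp
  have hcpos : 0 < c.im := h.g_mem hz0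
  have hcircle : ∀ w ∈ UHP, ‖f w - x₀‖ = 2 * ρ → ‖w - c.re‖ ≤ 28 * ρ := by
    intro w hw hfw
    have hfU : 0 < (f w).im := (h.f_mem hw).1
    set θ := arg (f w - x₀) with hθ
    have e1 : f w = x₀ + (2 * ρ : ℝ) * exp (θ * I) := by
      have := norm_mul_exp_arg_mul_I (f w - x₀)
      rw [hfw] at this
      rw [this]; ring
    have him : (f w - x₀).im = (f w).im := by simp
    have hθm : θ ∈ Ioo 0 Real.pi := by
      have h1 : 0 ≤ θ := arg_nonneg_iff.2 (by rw [him]; exact hfU.le)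
      have h2 := arg_le_pi (f w - x₀)
      refine ⟨lt_of_le_of_ne h1 ?_, lt_of_le_of_ne h2 ?_⟩
      · intro h3
        have := (arg_eq_zero_iff.1 h3.symm).2
        rw [him] at this; linarith
      · intro h3
        have := (arg_eq_pi_iff.1 h3).2
        rw [him] at this; linarith
    have h5 := hlip θ hθm (Real.pi / 2) ⟨by linarith, by linarith⟩
    rw [← hc, ← e1, h.gf hw] at h5
    have h6 : ‖θ - Real.pi / 2‖ ≤ 3.15 := by
      rw [Real.norm_eq_abs, abs_le]; constructor <;> linarith [hθm.1, hθm.2]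
    have h7 : ‖c - c.re‖ ≤ 2 * ρ := by
      have : c - c.re = c.im * I := by apply Complex.ext <;> simp
      rw [this, norm_mul, norm_I, norm_real, Real.norm_eq_abs, abs_of_pos hcpos]; linarith
    calc ‖w - c.re‖ ≤ ‖w - c‖ + ‖c - c.re‖ := norm_sub_le_norm_sub_add_norm_sub _ _ _
      _ ≤ 8 * ρ * 3.15 + 2 * ρ := add_le_add (h5.trans (by gcongr)) h7
      _ ≤ _ := by nlinarith
  refine ⟨c.re, fun w hw hfw => ?_⟩
  by_contra hcon
  push Not at hcon
  have hwne : 0 < ‖w - c.re‖ := by linarith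
  have hray : ∀ t : ℝ, 1 ≤ t → (c.re + t * (w - c.re) : ℂ) ∈ UHP := by
    intro t ht
    have : 0 < w.im := hw
    rw [mem_UHP]
    simp; nlinarith
  obtain ⟨R, hR, hRf⟩ := h.exists_far one_pos
  obtain ⟨T, hT1, hT2, hT3⟩ : ∃ T : ℝ, 1 ≤ T ∧ R ≤ T * ‖w - c.re‖ - |c.re| ∧
      2 * ρ + 1 + |x₀| ≤ T * ‖w - c.re‖ - |c.re| := by
    have ht : Tendsto (fun T : ℝ => T * ‖w - c.re‖ - |c.re|) atTop atTop :=
      tendsto_atTop_add_const_right _ _ (tendsto_id.atTop_mul_const hwne)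
    exact ((eventually_ge_atTop 1).and ((ht.eventually_ge_atTop R).and (ht.eventually_ge_atTop _))).exists
  have hcont : ContinuousOn (fun t : ℝ => ‖f (c.re + t * (w - c.re)) - x₀‖) (Icc 1 T) := by
    refine ContinuousOn.norm (ContinuousOn.sub ?_ continuousOn_const)
    refine h.fd.continuousOn.comp (by fun_prop) ?_
    intro t ht; exact hray t ht.1
  have hn : T * ‖w - c.re‖ - |c.re| ≤ ‖(c.re + T * (w - c.re) : ℂ)‖ := by
    have := norm_sub_norm_le (T * (w - c.re) : ℂ) (-(c.re:ℂ))
    rw [norm_mul, norm_neg, norm_real, norm_real, Real.norm_eq_abs, Real.norm_eq_abs,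
      abs_of_pos (by linarith : 0 < T)] at this
    refine this.trans_eq ?_
    congr 1; ring
  have hend : 2 * ρ ≤ ‖f (c.re + T * (w - c.re)) - x₀‖ := by
    have h1 := hRf _ (hray T hT1) (hT2.trans hn)
    set q : ℂ := c.re + T * (w - c.re)
    have h2 : ‖q‖ ≤ ‖f q - q‖ + ‖f q - x₀‖ + |x₀| := by
      calc ‖q‖ = ‖-(f q - q) + (f q - x₀) + x₀‖ := by congr 1; ring
        _ ≤ ‖-(f q - q)‖ + ‖f q - x₀‖ + ‖(x₀:ℂ)‖ := norm_add₃_le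
        _ = _ := by rw [norm_neg, norm_real, Real.norm_eq_abs]
    linarith
  obtain ⟨t, ht, hft⟩ := intermediate_value_Icc hT1 hcont
    (show 2 * ρ ∈ Icc _ _ from ⟨by simpa using hfw.le, hend⟩)
  have h8 := hcircle _ (hray t ht.1) hft
  rw [add_sub_cancel_left, norm_mul, norm_real, Real.norm_eq_abs, abs_of_pos (by linarith [ht.1])] at h8
  nlinarith [ht.1]

lemma mem_closure_UHP {x : ℂ} (hx : 0 ≤ x.im) : x ∈ closure UHP := by
  have : closure UHP = {z : ℂ | 0 ≤ z.im} := closure_setOfPred_lt_im 0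
  rw [this]; exact hx

lemma neBot {x : ℂ} (hx : 0 ≤ x.im) : (nhdsWithin x UHP).NeBot :=
  mem_closure_iff_nhdsWithin_neBot.1 (mem_closure_UHP hx)

lemma exists_ext {β C₀ : ℝ} (hβ : 0 < β) (hH : IsHolder f β C₀) :
    ∃ fb : ℂ → ℂ, ∀ x : ℂ, 0 ≤ x.im → Tendsto f (nhdsWithin x UHP) (nhds (fb x)) := by
  have : ∀ x : ℂ, ∃ y, 0 ≤ x.im → Tendsto f (nhdsWithin x UHP) (nhds y) := by
    intro x
    by_cases hx : 0 ≤ x.im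
    swap
    · exact ⟨0, fun h => absurd h hx⟩
    have := neBot hx
    have hc : Cauchy (map f (nhdsWithin x UHP)) := by
      rw [Metric.cauchy_iff]
      refine ⟨inferInstance, fun ε hε => ?_⟩
      have ht : Tendsto (fun d : ℝ => C₀ * max (d ^ β) d) (nhds 0) (nhds 0) := by
        have : Continuous (fun d : ℝ => C₀ * max (d ^ β) d) :=
          continuous_const.mul ((continuous_id.rpow_const (fun _ => Or.inr hβ.le)).max continuous_id)
        simpa [Real.zero_rpow hβ.ne'] using this.tendsto 0
      obtain ⟨δ, hδ, hd⟩ := Metric.eventually_nhds_iff.1 (ht.eventually (Iio_mem_nhds hε))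
      refine ⟨f '' (ball x (δ/2) ∩ UHP), image_mem_map ?_, ?_⟩
      · rw [inter_comm]; exact inter_mem_nhdsWithin _ (ball_mem_nhds _ (half_pos hδ))
      · rintro _ ⟨a, ⟨ha, haU⟩, rfl⟩ _ ⟨b, ⟨hb, hbU⟩, rfl⟩
        refine (hH a haU b hbU).trans_lt (hd ?_)
        rw [Real.dist_eq, sub_zero, abs_of_nonneg dist_nonneg]
        have := dist_triangle_right a b x
        rw [mem_ball] at ha hb
        linarith
    obtain ⟨y, hy⟩ := CompleteSpace.complete hc
    exact ⟨y, fun _ => hy⟩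
  choose fb hfb using this
  exact ⟨fb, hfb⟩

/-- Hölder bound at a limit point. -/
lemma holder_lim {β C₀ : ℝ} (hβ : 0 < β) (hH : IsHolder f β C₀) {x y : ℂ} (hx : 0 ≤ x.im)
    (hxy : Tendsto f (nhdsWithin x UHP) (nhds y)) {w : ℂ} (hw : w ∈ UHP) :
    ‖f w - y‖ ≤ C₀ * max (‖w - x‖ ^ β) ‖w - x‖ := by
  have := neBot hx
  have hcont : Continuous (fun d : ℝ => C₀ * max (d ^ β) d) :=
    continuous_const.mul ((continuous_id.rpow_const (fun _ => Or.inr hβ.le)).max continuous_id)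
  have h1 : Tendsto (fun v => ‖f w - f v‖) (nhdsWithin x UHP) (nhds ‖f w - y‖) :=
    (tendsto_const_nhds.sub hxy).norm
  have h2 : Tendsto (fun v => C₀ * max (‖w - v‖ ^ β) ‖w - v‖) (nhdsWithin x UHP)
      (nhds (C₀ * max (‖w - x‖ ^ β) ‖w - x‖)) := by
    refine (hcont.tendsto _).comp ?_
    exact ((continuous_const.sub continuous_id).norm.tendsto x).mono_left nhdsWithin_le_nhds
  refine le_of_tendsto_of_tendsto h1 h2 ?_
  filter_upwards [self_mem_nhdsWithin] with v hv
  have := hH w hw v hv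
  rwa [dist_eq_norm, dist_eq_norm] at this

lemma ext_continuous {β C₀ : ℝ} (hβ : 0 < β) (hH : IsHolder f β C₀) {fb : ℂ → ℂ}
    (hfb : ∀ x : ℂ, 0 ≤ x.im → Tendsto f (nhdsWithin x UHP) (nhds (fb x))) :
    Continuous (fun x : ℝ => fb x) := by
  have hcont : Continuous (fun d : ℝ => C₀ * max (d ^ β) d) :=
    continuous_const.mul ((continuous_id.rpow_const (fun _ => Or.inr hβ.le)).max continuous_id)
  rw [continuous_iff_continuousAt]
  intro x
  have hb : ∀ y : ℝ, ‖fb y - fb x‖ ≤ C₀ * max (‖(y:ℂ) - x‖ ^ β) ‖(y:ℂ) - x‖ := by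
    intro y
    have := neBot (x := (y:ℂ)) (by simp)
    have h1 : Tendsto (fun v => ‖f v - fb x‖) (nhdsWithin (y:ℂ) UHP) (nhds ‖fb y - fb x‖) :=
      ((hfb y (by simp)).sub tendsto_const_nhds).norm
    have h2 : Tendsto (fun v : ℂ => C₀ * max (‖v - x‖ ^ β) ‖v - x‖) (nhdsWithin (y:ℂ) UHP)
        (nhds (C₀ * max (‖(y:ℂ) - x‖ ^ β) ‖(y:ℂ) - x‖)) := by
      refine (hcont.tendsto _).comp ?_
      exact ((continuous_id.sub continuous_const).norm.tendsto (y:ℂ)).mono_left nhdsWithin_le_nhds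
    refine le_of_tendsto_of_tendsto h1 h2 ?_
    filter_upwards [self_mem_nhdsWithin] with v hv
    exact holder_lim hβ hH (by simp) (hfb x (by simp)) hv
  rw [ContinuousAt, tendsto_iff_norm_sub_tendsto_zero]
  refine squeeze_zero (fun _ => norm_nonneg _) hb ?_
  have h3 : Continuous fun y : ℝ => C₀ * max (‖(y:ℂ) - x‖ ^ β) ‖(y:ℂ) - x‖ :=
    hcont.comp (by fun_prop : Continuous fun y : ℝ => ‖(y:ℂ) - x‖)
  simpa [Real.zero_rpow hβ.ne'] using h3.tendsto x

/-- boundary values are not in the domain -/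
lemma bdry_not_mem (h : Hyd K f g) {x y : ℂ} (hx0 : x.im = 0)
    (hxy : Tendsto f (nhdsWithin x UHP) (nhds y)) : y ∉ UHP \ K := by
  intro hy
  have := neBot (x := x) hx0.ge
  have h1 : Tendsto (fun w => g (f w)) (nhdsWithin x UHP) (nhds (g y)) := (h.g_cont hy).tendsto.comp hxy
  have h2 : Tendsto (fun w => g (f w)) (nhdsWithin x UHP) (nhds x) := by
    refine Tendsto.congr' ?_ (tendsto_id.mono_left (nhdsWithin_le_nhds (s := UHP)))
    filter_upwards [self_mem_nhdsWithin] with w hw using (h.gf hw).symm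
  have h3 := tendsto_nhds_unique h1 h2
  have h4 : 0 < (g y).im := h.g_mem hy
  rw [h3] at h4; linarith

lemma bdry_im_nonneg (h : Hyd K f g) {x y : ℂ} (hx0 : x.im = 0)
    (hxy : Tendsto f (nhdsWithin x UHP) (nhds y)) : 0 ≤ y.im := by
  have := neBot (x := x) hx0.ge
  refine ge_of_tendsto ((continuous_im.tendsto y).comp hxy) ?_
  filter_upwards [self_mem_nhdsWithin] with w hw
  exact le_of_lt (h.f_mem hw).1

lemma exists_xstar (h : Hyd K f g) {x₀ ρ β C₀ : ℝ} (hρ : 0 < ρ) (hK : K ⊆ closedBall (x₀ : ℂ) ρ)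
    (hKc : IsClosed (insert (x₀:ℂ) K)) (hβ : 0 < β) (hH : IsHolder f β C₀) {fb : ℂ → ℂ}
    (hfb : ∀ x : ℂ, 0 ≤ x.im → Tendsto f (nhdsWithin x UHP) (nhds (fb x)))
    (hne : ∃ x : ℝ, fb x ∈ K) :
    ∃ xs : ℝ, fb xs = x₀ ∧ (∀ x : ℝ, fb x ∈ K → x < xs) ∧
      (∀ s : ℝ, x₀ < s → ∃ x' : ℝ, xs < x' ∧ fb x' = s) ∧
      (∀ w ∈ UHP, ‖f w - x₀‖ < 2 * ρ → ‖w - xs‖ ≤ 56 * ρ) := by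
  obtain ⟨c, hc⟩ := h.R_bound hρ hK
  have hcont := ext_continuous hβ hH hfb
  set S : Set ℝ := {x : ℝ | fb x ∈ insert (x₀:ℂ) K} with hS
  have hSc : IsClosed S := hKc.preimage hcont
  have hlimc : ∀ x : ℝ, ‖fb x - x₀‖ < 2 * ρ → ‖(x:ℂ) - c‖ ≤ 28 * ρ := by
    intro x hx
    have := neBot (x := (x:ℂ)) (by simp)
    have h1 : Tendsto (fun v : ℂ => ‖v - c‖) (nhdsWithin (x:ℂ) UHP) (nhds ‖(x:ℂ) - c‖) :=
      ((continuous_id.sub continuous_const).norm.tendsto (x:ℂ)).mono_left nhdsWithin_le_nhds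
    refine le_of_tendsto h1 ?_
    have h2 := ((hfb x (by simp)).sub (tendsto_const_nhds (x := (x₀:ℂ)))).norm
    filter_upwards [self_mem_nhdsWithin, h2.eventually (Iio_mem_nhds hx)] with v hv hv2
    exact hc v hv hv2
  have hSb : ∀ x ∈ S, ‖(x:ℂ) - c‖ ≤ 28 * ρ := by
    intro x hx
    apply hlimc
    rcases hx with hx | hx
    · rw [hx]; simpa using hρ
    · have := hK hx
      rw [mem_closedBall, dist_eq_norm] at this; linarith
  have hbdd : BddAbove S := ⟨c + 28 * ρ, fun x hx => by
    have := hSb x hx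
    rw [← ofReal_sub, norm_real, Real.norm_eq_abs] at this
    linarith [(abs_le.1 this).2]⟩
  have hne' : S.Nonempty := by
    obtain ⟨x, hx⟩ := hne; exact ⟨x, Or.inr hx⟩
  set xs := sSup S with hxs
  have hxsS : xs ∈ S := hSc.csSup_mem hne' hbdd
  have hgt : ∀ x : ℝ, xs < x → (fb x).im = 0 := by
    intro x hx
    have hxS : x ∉ S := fun hh => absurd (le_csSup hbdd hh) (not_le.2 hx)
    have h1 := h.bdry_not_mem (x := (x:ℂ)) (by simp) (hfb x (by simp))
    have h2 := h.bdry_im_nonneg (x := (x:ℂ)) (by simp) (hfb x (by simp))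
    by_contra h3
    exact h1 ⟨lt_of_le_of_ne h2 (Ne.symm h3), fun hk => hxS (Or.inr hk)⟩
  have him : (fb xs).im = 0 := by
    have h1 : Tendsto (fun x : ℝ => (fb x).im) (nhdsWithin xs (Ioi xs)) (nhds (fb xs).im) :=
      ((continuous_im.comp hcont).tendsto xs).mono_left nhdsWithin_le_nhds
    have h2 : Tendsto (fun x : ℝ => (fb x).im) (nhdsWithin xs (Ioi xs)) (nhds 0) := by
      refine Tendsto.congr' ?_ tendsto_const_nhds
      filter_upwards [self_mem_nhdsWithin] with x hx using (hgt x hx).symm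
    exact tendsto_nhds_unique h1 h2
  have hfxs : fb xs = x₀ := by
    rcases hxsS with h1 | h1
    · exact h1
    · have : 0 < (fb xs).im := h.hKU h1
      linarith
  refine ⟨xs, hfxs, ?_, ?_, ?_⟩
  · intro x hx
    refine lt_of_le_of_ne (le_csSup hbdd (Or.inr hx)) ?_
    rintro rfl
    have : 0 < (fb xs).im := h.hKU hx
    linarith
  · intro s hs
    obtain ⟨R, hR, hRf⟩ := h.exists_far one_pos
    set X := max (max (R + 1) (s + 1)) (xs + 1) with hX
    have hX1 : R + 1 ≤ X := (le_max_left _ _).trans (le_max_left _ _)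
    have hX2 : s + 1 ≤ X := (le_max_right _ _).trans (le_max_left _ _)
    have hX3 : xs + 1 ≤ X := le_max_right _ _
    have hfar : ‖fb X - X‖ ≤ 1 := by
      have := neBot (x := (X:ℂ)) (by simp)
      have h1 : Tendsto (fun v : ℂ => ‖f v - v‖) (nhdsWithin (X:ℂ) UHP) (nhds ‖fb X - X‖) :=
        ((hfb X (by simp)).sub (tendsto_id.mono_left nhdsWithin_le_nhds)).norm
      refine le_of_tendsto h1 ?_
      have h2 : Tendsto (fun v : ℂ => ‖v‖) (nhdsWithin (X:ℂ) UHP) (nhds ‖(X:ℂ)‖) :=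
        (continuous_norm.tendsto _).mono_left nhdsWithin_le_nhds
      have h3 : R < ‖(X:ℂ)‖ := by
        rw [norm_real, Real.norm_eq_abs, abs_of_pos (by linarith)]; linarith
      filter_upwards [self_mem_nhdsWithin, h2.eventually (Ioi_mem_nhds h3)] with v hv hv2
      exact (hRf v hv (le_of_lt hv2)).le
    have hre : s ≤ (fb X).re := by
      have := (abs_re_le_norm _).trans hfar
      rw [sub_re, ofReal_re, abs_le] at this
      linarith [this.1]
    obtain ⟨x', hx', hx'2⟩ := intermediate_value_Icc (by linarith : xs ≤ X)
      ((continuous_re.comp hcont).continuousOn (s := Icc xs X))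
      (show s ∈ Icc _ _ from ⟨by simp [hfxs, hs.le], hre⟩)
    have hne2 : xs < x' := by
      refine lt_of_le_of_ne hx'.1 ?_
      rintro rfl
      simp [hfxs] at hx'2
      linarith
    refine ⟨x', hne2, Complex.ext ?_ ?_⟩
    · simpa using hx'2
    · simpa using hgt x' hne2
  · intro w hw hfw
    have h1 := hc w hw hfw
    have h2 := hSb xs hxsS
    calc ‖w - xs‖ = ‖(w - c) - (xs - c)‖ := by congr 1; ring
      _ ≤ ‖w - c‖ + ‖(xs:ℂ) - c‖ := norm_sub_le _ _
      _ ≤ _ := by linarith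

end Hyd

lemma sq_int_lower {h h' : ℝ → ℂ} {a b m T : ℝ} (hab : a ≤ b)
    (hd : ∀ x ∈ Icc a b, HasDerivAt h (h' x) x) (hc : ContinuousOn h' (Icc a b))
    (hT : 0 < T) (hbT : b - a ≤ T) (hm : m ≤ ‖h b - h a‖) (hm0 : 0 ≤ m) :
    m ^ 2 / T ≤ ∫ x in a..b, ‖h' x‖ ^ 2 := by
  have hc' : ContinuousOn h' (uIcc a b) := by rwa [uIcc_of_le hab]
  have h1 : ∫ x in a..b, h' x = h b - h a :=
    intervalIntegral.integral_eq_sub_of_hasDerivAt (fun x hx => hd x (by rwa [uIcc_of_le hab] at hx))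
      hc'.intervalIntegrable
  have h2 : m ≤ ∫ x in a..b, ‖h' x‖ := by
    rw [← h1] at hm
    exact hm.trans (intervalIntegral.norm_integral_le_integral_norm hab)
  set t := m / T with ht
  have h3 : ∫ x in a..b, (2 * t * ‖h' x‖ - t ^ 2) ≤ ∫ x in a..b, ‖h' x‖ ^ 2 := by
    apply intervalIntegral.integral_mono_on hab
    · exact ((continuousOn_const.mul hc'.norm).sub continuousOn_const).intervalIntegrable
    · exact (hc'.norm.pow 2).intervalIntegrable
    · intro x _
      nlinarith [sq_nonneg (‖h' x‖ - t)]
  rw [intervalIntegral.integral_sub (hc'.norm.intervalIntegrable.const_mul _)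
    (continuousOn_const.intervalIntegrable), intervalIntegral.integral_const_mul,
    intervalIntegral.integral_const, smul_eq_mul] at h3
  have ht0 : 0 ≤ t := by positivity
  have e : m ^ 2 / T = 2 * t * m - T * t ^ 2 := by rw [ht]; field_simp; ring
  rw [e]
  have h4 : 2 * t * m ≤ 2 * t * ∫ x in a..b, ‖h' x‖ := by gcongr
  have h5 : (b - a) * t ^ 2 ≤ T * t ^ 2 := by gcongr
  linarith

namespace Hyd
variable {K : Set ℂ} {f g : ℂ → ℂ}

lemma g_tendsto_real (h : Hyd K f g) {x₀ y x' : ℝ} (hKc : IsClosed (insert (x₀:ℂ) K))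
    (hy : (y:ℂ) ∉ insert (x₀:ℂ) K) (hx' : Tendsto f (nhdsWithin (x':ℂ) UHP) (nhds (y:ℂ))) :
    Tendsto g (nhdsWithin (y:ℂ) UHP) (nhds (x':ℂ)) := by
  obtain ⟨η, hη, hηb⟩ := Metric.isOpen_iff.1 hKc.isOpen_compl (y:ℂ) hy
  set U := ball (y:ℂ) (η/2) ∩ UHP with hU
  have hb : ∀ z ∈ U, ball z z.im ⊆ UHP \ K := by
    intro z hz v hv
    have hz2 : 0 < z.im := hz.2
    have hz3 := hz.1
    rw [mem_ball, dist_eq_norm] at hv hz3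
    have h1 : z.im < η / 2 := by
      have := (abs_im_le_norm _).trans_lt hz3
      rw [sub_im, ofReal_im, sub_zero, abs_lt] at this
      exact this.2
    refine ⟨?_, fun hvK => ?_⟩
    · have := (abs_im_le_norm _).trans_lt hv
      rw [sub_im, abs_lt] at this
      rw [mem_UHP]; linarith [this.1]
    · have : v ∈ ball (y:ℂ) η := by
        rw [mem_ball, dist_eq_norm]
        have := norm_sub_le_norm_sub_add_norm_sub v z (y:ℂ)
        linarith
      exact hηb this (Or.inr hvK)
  have hUK : U ⊆ UHP \ K := fun z hz => hb z hz (mem_ball_self hz.2)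
  have hlip : ∀ z ∈ U, ∀ z' ∈ U, ‖g z - g z'‖ ≤ 2 * ‖z - z'‖ := by
    intro z hz z' hz'
    refine ((convex_ball (y:ℂ) (η/2)).inter convex_UHP).norm_image_sub_le_of_norm_hasDerivWithin_le
      (f' := deriv g) (fun v hv => (h.g_diff (hUK hv)).hasDerivAt.hasDerivWithinAt) ?_ hz' hz
    intro v hv
    have hv2 : 0 < v.im := hv.2
    have := h.deriv_le hv2 (hb v hv)
    rwa [mul_div_assoc, div_self hv2.ne', mul_one] at this
  have hUn : U ∈ nhdsWithin (y:ℂ) UHP := by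
    rw [hU, inter_comm]; exact inter_mem_nhdsWithin _ (ball_mem_nhds _ (half_pos hη))
  have hbound : ∀ z ∈ U, ‖g z - x'‖ ≤ 2 * ‖z - y‖ := by
    intro z hz
    have := neBot (x := (x':ℂ)) (by simp)
    have h1 : Tendsto (fun w : ℂ => ‖g z - w‖) (nhdsWithin (x':ℂ) UHP) (nhds ‖g z - x'‖) :=
      ((continuous_const.sub continuous_id).norm.tendsto (x':ℂ)).mono_left nhdsWithin_le_nhds
    have h2 : Tendsto (fun w : ℂ => 2 * ‖z - f w‖) (nhdsWithin (x':ℂ) UHP) (nhds (2 * ‖z - y‖)) :=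
      ((tendsto_const_nhds.sub hx').norm).const_mul 2
    refine le_of_tendsto_of_tendsto h1 h2 ?_
    filter_upwards [self_mem_nhdsWithin, hx'.eventually (ball_mem_nhds _ (half_pos hη))] with w hw hw2
    have := hlip z hz (f w) ⟨hw2, (h.f_mem hw).1⟩
    rwa [h.gf hw] at this
  rw [tendsto_iff_norm_sub_tendsto_zero]
  refine squeeze_zero' (Eventually.of_forall fun _ => norm_nonneg _)
    (by filter_upwards [hUn] with z hz using hbound z hz) ?_
  have : Continuous fun z : ℂ => 2 * ‖z - y‖ := by fun_prop
  simpa using (this.tendsto (y:ℂ)).mono_left (nhdsWithin_le_nhds (s := UHP))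

/-- the energy density -/
def dens (g : ℂ → ℂ) (xs lam : ℝ) (z : ℂ) : ℝ :=
  lam * ‖deriv g z / (g z - xs)‖ ^ 2 + ‖1 - deriv g z‖ ^ 2 / lam

lemma slice (h : Hyd K f g) {x₀ ρ : ℝ} (hKc : IsClosed (insert (x₀:ℂ) K)) {fb : ℂ → ℂ}
    (hfb : ∀ x : ℂ, 0 ≤ x.im → Tendsto f (nhdsWithin x UHP) (nhds (fb x)))
    {xs : ℝ} (hxK : ∀ x : ℝ, fb x ∈ K → x < xs)
    (hxr : ∀ s : ℝ, x₀ < s → ∃ x' : ℝ, xs < x' ∧ fb x' = s)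
    (hR : ∀ w ∈ UHP, ‖f w - x₀‖ < 2 * ρ → ‖w - xs‖ ≤ 56 * ρ)
    {s θ₀ lam : ℝ} (hs : 0 < s) (hsρ : s < 2 * ρ) (hθ : 0 < θ₀) (hθ2 : θ₀ ≤ Real.pi / 2)
    (hlam : 0 < lam)
    (hout : ∀ θ ∈ Ioo 0 θ₀, (x₀ + s * exp (θ * I) : ℂ) ∉ K)
    (hin : (x₀ + s * exp (θ₀ * I) : ℂ) ∈ K) :
    ∃ θ₁ θ₂, 0 < θ₁ ∧ θ₁ ≤ θ₂ ∧ θ₂ < θ₀ ∧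
      (∀ θ ∈ Icc θ₁ θ₂, (x₀ + s * exp (θ * I) : ℂ) ∈ UHP \ K) ∧
      ContinuousOn (fun θ : ℝ => dens g xs lam (x₀ + s * exp (θ * I))) (Icc θ₁ θ₂) ∧
      1 / 2 ≤ ∫ θ in θ₁..θ₂, s * dens g xs lam (x₀ + s * exp (θ * I)) := by
  have hpi := Real.pi_gt_three
  set p : ℝ → ℂ := fun θ => x₀ + s * exp (θ * I) with hp
  have hpc : Continuous p := by fun_prop
  have hpim : ∀ θ, (p θ).im = s * Real.sin θ := by
    intro θ; simp [hp, exp_im, exp_re]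
  have hpn : ∀ θ, ‖p θ - x₀‖ = s := by
    intro θ
    simp only [hp, add_sub_cancel_left]
    rw [norm_mul, norm_exp_ofReal_mul_I, norm_real, Real.norm_eq_abs, abs_of_pos hs, mul_one]
  have hpU : ∀ θ ∈ Ioo 0 θ₀, p θ ∈ UHP \ K := by
    intro θ hθ'
    refine ⟨?_, hout θ hθ'⟩
    rw [mem_UHP, hpim]
    exact mul_pos hs (Real.sin_pos_of_pos_of_lt_pi hθ'.1 (by linarith [hθ'.2]))
  have hsin0 : 0 < Real.sin θ₀ := Real.sin_pos_of_pos_of_lt_pi hθ (by linarith)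
  have hjord : 2 / Real.pi * θ₀ ≤ Real.sin θ₀ := Real.mul_le_sin hθ.le hθ2
  -- bottom
  obtain ⟨x', hx'1, hx'2⟩ := hxr (x₀ + s) (by linarith)
  have hbot : Tendsto (fun θ => g (p θ)) (nhdsWithin 0 (Ioi 0)) (nhds (x':ℂ)) := by
    have h1 : ((x₀ + s : ℝ) : ℂ) ∉ insert (x₀:ℂ) K := by
      rintro (h2 | h2)
      · have := ofReal_injective h2; linarith
      · have := h.hKU h2
        rw [mem_UHP, ofReal_im] at this; linarith
    have h2 := h.g_tendsto_real hKc h1 (x' := x') (by rw [← hx'2]; exact hfb x' (by simp))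
    refine h2.comp (tendsto_nhdsWithin_iff.2 ⟨?_, ?_⟩)
    · have := hpc.tendsto 0
      simp only [hp, ofReal_zero, zero_mul, exp_zero, mul_one] at this
      push_cast
      exact this.mono_left nhdsWithin_le_nhds
    · filter_upwards [Ioo_mem_nhdsGT hθ] with θ hθ' using (hpU θ hθ').1
  have harg1 : ∀ᶠ θ in nhdsWithin 0 (Ioi 0), (log (g (p θ) - xs)).im < 1 := by
    have h1 : ((x':ℂ) - xs) ∈ slitPlane := by
      left; simp [hx'1]
    have h2 : Tendsto (fun θ => (log (g (p θ) - xs)).im) (nhdsWithin 0 (Ioi 0))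
        (nhds (log ((x':ℂ) - xs)).im) :=
      (continuous_im.tendsto _).comp (((hbot.sub_const (xs:ℂ))).clog h1)
    have h3 : (log ((x':ℂ) - xs)).im = 0 := by
      rw [log_im, ← ofReal_sub, arg_ofReal_of_nonneg (by linarith)]
    rw [h3] at h2
    exact h2.eventually (Iio_mem_nhds one_pos)
  have hV1 : ∀ᶠ θ in nhdsWithin 0 (Ioi 0), s * Real.sin θ < s * Real.sin θ₀ / 4 := by
    have : Continuous fun θ => s * Real.sin θ := by fun_prop
    have h1 := (this.tendsto 0).mono_left (nhdsWithin_le_nhds (s := Ioi 0))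
    rw [Real.sin_zero, mul_zero] at h1
    exact h1.eventually (Iio_mem_nhds (by positivity))
  obtain ⟨θ₁, hA1, hB1, hθ₁⟩ := (harg1.and (hV1.and (Ioo_mem_nhdsGT (half_pos hθ)))).exists
  -- top
  set u : ℕ → ℝ := fun n => θ₀ - θ₀ / 2 / (n + 1) with hu
  have hu1 : ∀ n, u n ∈ Ico (θ₀ / 2) θ₀ := by
    intro n
    have h1 : θ₀ / 2 / ((n:ℝ) + 1) ≤ θ₀ / 2 := div_le_self (half_pos hθ).le (by linarith [n.cast_nonneg (α := ℝ)])
    have h2 : 0 < θ₀ / 2 / ((n:ℝ) + 1) := by positivity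
    exact ⟨by simp only [hu]; linarith, by simp only [hu]; linarith⟩
  have hu2 : Tendsto u atTop (nhds θ₀) := by
    have h1 : Tendsto (fun n : ℕ => θ₀ / 2 * (1 / ((n:ℝ) + 1))) atTop (nhds (θ₀ / 2 * 0)) :=
      tendsto_one_div_add_atTop_nhds_zero_nat.const_mul _
    have h2 := h1.const_sub θ₀
    simp only [mul_zero, sub_zero] at h2
    refine h2.congr fun n => ?_
    simp only [hu]; ring
  have hu3 : ∀ n, u n ∈ Ioo 0 θ₀ := fun n => ⟨by linarith [(hu1 n).1], (hu1 n).2⟩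
  have hbd : ∀ n, g (p (u n)) ∈ closedBall (xs:ℂ) (56 * ρ) := by
    intro n
    rw [mem_closedBall, dist_eq_norm]
    refine hR _ (h.g_mem (hpU _ (hu3 n))) ?_
    rw [h.fg (hpU _ (hu3 n)), hpn]; exact hsρ
  obtain ⟨wl, -, φ, hφ, hwl⟩ := (isCompact_closedBall (xs:ℂ) (56 * ρ)).tendsto_subseq hbd
  have hwlim : 0 ≤ wl.im := by
    refine ge_of_tendsto ((continuous_im.tendsto _).comp hwl) (Eventually.of_forall fun n => ?_)
    exact le_of_lt (h.g_mem (hpU _ (hu3 (φ n))))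
  have hwlU : Tendsto ((fun n => g (p (u n))) ∘ φ) atTop (nhdsWithin wl UHP) :=
    tendsto_nhdsWithin_iff.2 ⟨hwl, Eventually.of_forall fun n => h.g_mem (hpU _ (hu3 (φ n)))⟩
  have hfwl : fb wl = p θ₀ := by
    have h1 := (hfb wl hwlim).comp hwlU
    have h2 : Tendsto (fun n => p (u (φ n))) atTop (nhds (p θ₀)) :=
      (hpc.tendsto _).comp (hu2.comp hφ.tendsto_atTop)
    refine tendsto_nhds_unique (h1.congr fun n => ?_) h2
    exact h.fg (hpU _ (hu3 (φ n)))
  have hwl0 : wl.im = 0 := by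
    by_contra hne
    have hwU : wl ∈ UHP := lt_of_le_of_ne hwlim (Ne.symm hne)
    have h1 := hfb wl hwlim
    have := neBot hwlim
    have h2 : Tendsto f (nhdsWithin wl UHP) (nhds (f wl)) :=
      (h.fan hwU).continuousAt.tendsto.mono_left nhdsWithin_le_nhds
    have h3 := tendsto_nhds_unique h1 h2
    have h4 := (h.f_mem hwU).2
    rw [← h3, hfwl] at h4
    exact h4 hin
  have hwlr : wl = (wl.re : ℂ) := Complex.ext (by simp) (by simp [hwl0])
  have hwlx : wl.re < xs := hxK _ (by rw [← hwlr, hfwl]; exact hin)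
  have harg2 : ∀ᶠ n in atTop, 2 < (log (g (p (u (φ n))) - xs)).im := by
    have h1 : Tendsto (fun n => g (p (u (φ n))) - xs) atTop
        (nhdsWithin (wl - xs) {z : ℂ | 0 ≤ z.im}) := by
      refine tendsto_nhdsWithin_iff.2 ⟨hwl.sub_const _, Eventually.of_forall fun n => ?_⟩
      have : 0 < (g (p (u (φ n)))).im := h.g_mem (hpU _ (hu3 (φ n)))
      simp [this.le]
    have h2 := (continuousWithinAt_arg_of_re_neg_of_im_zero (z := wl - xs) (by simpa using hwlx)
      (by simp [hwl0])).tendsto.comp h1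
    have h3 : arg (wl - xs) = Real.pi := arg_eq_pi_iff.2 ⟨by simpa using hwlx, by simp [hwl0]⟩
    rw [h3] at h2
    filter_upwards [h2.eventually (Ioi_mem_nhds (by linarith : 2 < Real.pi))] with n hn
    rw [log_im]; exact hn
  have hV2 : ∀ᶠ n in atTop, 3 * (s * Real.sin θ₀) / 4 < (p (u (φ n)) - g (p (u (φ n)))).im := by
    have h1 : Tendsto (fun n => (p (u (φ n)) - g (p (u (φ n)))).im) atTop (nhds (p θ₀ - wl).im) :=
      (continuous_im.tendsto _).comp
        (((hpc.tendsto _).comp (hu2.comp hφ.tendsto_atTop)).sub hwl)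
    rw [sub_im, hwl0, hpim, sub_zero] at h1
    have : 0 < s * Real.sin θ₀ := by positivity
    exact h1.eventually (Ioi_mem_nhds (by linarith))
  obtain ⟨n, hA2, hB2⟩ := (harg2.and hV2).exists
  set θ₂ := u (φ n) with hθ₂
  have h12 : θ₁ ≤ θ₂ := by linarith [(hu1 (φ n)).1, hθ₁.2]
  have hθ20 : θ₂ < θ₀ := (hu3 (φ n)).2
  have hsub : Icc θ₁ θ₂ ⊆ Ioo 0 θ₀ := fun θ hθ' => ⟨hθ₁.1.trans_le hθ'.1, hθ'.2.trans_lt hθ20⟩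
  have hmem : ∀ θ ∈ Icc θ₁ θ₂, p θ ∈ UHP \ K := fun θ hθ' => hpU θ (hsub hθ')
  have hgne : ∀ θ ∈ Icc θ₁ θ₂, g (p θ) - xs ∈ slitPlane := by
    intro θ hθ'
    right
    have : 0 < (g (p θ)).im := h.g_mem (hmem θ hθ')
    simp [this.ne']
  have hpd : ∀ θ : ℝ, HasDerivAt p (s * (exp (θ * I) * I)) θ := by
    intro θ
    have h3 : HasDerivAt (fun θ : ℝ => (θ : ℂ) * I) I θ := by
      simpa using (Complex.ofRealCLM.hasDerivAt (x := θ)).mul_const I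
    exact (h3.cexp.const_mul _).const_add _
  have hgd : ∀ θ ∈ Icc θ₁ θ₂, HasDerivAt (fun θ => g (p θ)) (deriv g (p θ) * (s * (exp (θ * I) * I))) θ :=
    fun θ hθ' => (h.g_diff (hmem θ hθ')).hasDerivAt.comp θ (hpd θ)
  have hdc : ContinuousOn (fun θ => deriv g (p θ)) (Icc θ₁ θ₂) :=
    ((h.g_diffOn.deriv h.hopen).continuousOn).comp hpc.continuousOn hmem
  have hgc : ContinuousOn (fun θ => g (p θ)) (Icc θ₁ θ₂) :=
    h.g_diffOn.continuousOn.comp hpc.continuousOn hmem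
  have hne0 : ∀ θ ∈ Icc θ₁ θ₂, g (p θ) - xs ≠ 0 := fun θ hθ' => slitPlane_ne_zero (hgne θ hθ')
  have hΦ := sq_int_lower (h := fun θ => log (g (p θ) - xs))
    (h' := fun θ => deriv g (p θ) * (s * (exp (θ * I) * I)) / (g (p θ) - xs)) h12
    (fun θ hθ' => ((hgd θ hθ').sub_const _).clog_real (hgne θ hθ'))
    ((hdc.mul (by fun_prop)).div (hgc.sub continuousOn_const) hne0)
    hθ (by linarith [hθ₁.1]) (m := 1) (by
      refine le_trans ?_ (abs_im_le_norm _)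
      rw [sub_im]
      exact le_trans (by linarith) (le_abs_self _)) zero_le_one
  have hΨ := sq_int_lower (h := fun θ => p θ - g (p θ))
    (h' := fun θ => s * (exp (θ * I) * I) - deriv g (p θ) * (s * (exp (θ * I) * I))) h12
    (fun θ hθ' => (hpd θ).sub (hgd θ hθ'))
    ((Continuous.continuousOn (by fun_prop)).sub (hdc.mul (by fun_prop)))
    hθ (by linarith [hθ₁.1]) (m := s * θ₀ / 4) (by
      refine le_trans ?_ (abs_im_le_norm _)
      rw [sub_im]
      refine le_trans ?_ (le_abs_self _)
      have h1 : (p θ₁ - g (p θ₁)).im ≤ s * Real.sin θ₀ / 4 := by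
        have : 0 < (g (p θ₁)).im := h.g_mem (hmem θ₁ ⟨le_rfl, h12⟩)
        rw [sub_im, hpim]; linarith
      have h2 : θ₀ / 2 ≤ Real.sin θ₀ := by
        refine le_trans ?_ hjord
        have : (1:ℝ) / 2 ≤ 2 / Real.pi := by
          rw [div_le_div_iff₀ two_pos Real.pi_pos]; linarith [Real.pi_lt_four]
        nlinarith
      have h3 := mul_le_mul_of_nonneg_left h2 hs.le
      linarith) (by positivity)
  have hdensc : ContinuousOn (fun θ : ℝ => dens g xs lam (p θ)) (Icc θ₁ θ₂) := by
    unfold dens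
    exact (continuousOn_const.mul ((hdc.div (hgc.sub continuousOn_const) hne0).norm.pow 2)).add
      (((continuousOn_const.sub hdc).norm.pow 2).div_const _)
  refine ⟨θ₁, θ₂, hθ₁.1, h12, hθ20, hmem, hdensc, ?_⟩
  have hen : ∀ θ : ℝ, ‖(s * (exp (θ * I) * I) : ℂ)‖ = s := by
    intro θ
    rw [norm_mul, norm_mul, norm_exp_ofReal_mul_I, norm_I, norm_real, Real.norm_eq_abs, abs_of_pos hs]
    ring
  have hI1 : ∀ θ : ℝ, ‖deriv g (p θ) * (s * (exp (θ * I) * I)) / (g (p θ) - xs)‖ ^ 2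
      = s ^ 2 * ‖deriv g (p θ) / (g (p θ) - xs)‖ ^ 2 := by
    intro θ
    rw [mul_div_right_comm, norm_mul, hen]; ring
  have hI2 : ∀ θ : ℝ, ‖s * (exp (θ * I) * I) - deriv g (p θ) * (s * (exp (θ * I) * I))‖ ^ 2
      = s ^ 2 * ‖1 - deriv g (p θ)‖ ^ 2 := by
    intro θ
    rw [← one_sub_mul, norm_mul, hen]; ring
  simp only [hI1, hI2] at hΦ hΨ
  rw [intervalIntegral.integral_const_mul] at hΦ hΨ ⊢
  have hc1 : ContinuousOn (fun θ => ‖deriv g (p θ) / (g (p θ) - xs)‖ ^ 2) (uIcc θ₁ θ₂) := by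
    rw [uIcc_of_le h12]; exact (hdc.div (hgc.sub continuousOn_const) hne0).norm.pow 2
  have hc2 : ContinuousOn (fun θ => ‖1 - deriv g (p θ)‖ ^ 2) (uIcc θ₁ θ₂) := by
    rw [uIcc_of_le h12]; exact (continuousOn_const.sub hdc).norm.pow 2
  have hsplit : ∫ θ in θ₁..θ₂, dens g xs lam (p θ) =
      lam * (∫ θ in θ₁..θ₂, ‖deriv g (p θ) / (g (p θ) - xs)‖ ^ 2) +
      (∫ θ in θ₁..θ₂, ‖1 - deriv g (p θ)‖ ^ 2) / lam := by
    unfold dens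
    rw [intervalIntegral.integral_add (hc1.intervalIntegrable.const_mul _) (hc2.intervalIntegrable.div_const _),
      intervalIntegral.integral_const_mul, intervalIntegral.integral_div]
  rw [hsplit]
  set A := ∫ θ in θ₁..θ₂, ‖deriv g (p θ) / (g (p θ) - xs)‖ ^ 2
  set B := ∫ θ in θ₁..θ₂, ‖1 - deriv g (p θ)‖ ^ 2
  have hA : 1 / (s ^ 2 * θ₀) ≤ A := by
    rw [div_le_iff₀ (by positivity)]
    rw [div_le_iff₀ hθ] at hΦ
    linarith
  have hB : θ₀ / 16 ≤ B := by
    rw [div_le_iff₀ hθ] at hΨ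
    have h1 : s ^ 2 * θ₀ * (θ₀ / 16) ≤ s ^ 2 * θ₀ * B := by linarith
    exact le_of_mul_le_mul_left h1 (by positivity)
  calc (1:ℝ) / 2 ≤ s * (lam * (1 / (s ^ 2 * θ₀)) + θ₀ / 16 / lam) := by
        have : s * (lam * (1 / (s ^ 2 * θ₀)) + θ₀ / 16 / lam) - 1 / 2
          = (4 * lam - s * θ₀) ^ 2 / (16 * s * θ₀ * lam) := by
          field_simp; ring
        have h2 : 0 ≤ (4 * lam - s * θ₀) ^ 2 / (16 * s * θ₀ * lam) := by positivity
        linarith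
    _ ≤ s * (lam * A + B / lam) := by gcongr

end Hyd

namespace Hyd
open MeasureTheory
variable {K : Set ℂ} {f g : ℂ → ℂ}

lemma det_smul_one (c : ℂ) : ((c • (1 : ℂ →L[ℝ] ℂ)).det) = ‖c‖^2 := by
  have h1 : ((c • (1 : ℂ →L[ℝ] ℂ) : ℂ →L[ℝ] ℂ) : ℂ →ₗ[ℝ] ℂ) = Algebra.lmul ℝ ℂ c := by
    ext; simp
  rw [ContinuousLinearMap.det, h1, ← Algebra.norm_apply, Algebra.norm_complex_apply,
    normSq_eq_norm_sq]

lemma volume_reProdIm (s t : Set ℝ) :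
    volume (s ×ℂ t) = volume s * volume t := by
  have h1 : s ×ℂ t = measurableEquivRealProd ⁻¹' (s ×ˢ t) := by
    ext z; simp [mem_reProdIm]
  rw [h1, volume_preserving_equiv_real_prod.measure_preimage_equiv, Measure.volume_eq_prod,
    Measure.prod_prod]

lemma setIntegral_reProdIm {h : ℂ → ℂ} {s t : Set ℝ} (hi : IntegrableOn h (s ×ℂ t)) :
    ∫ z in s ×ℂ t, h z = ∫ y in t, ∫ x in s, h (x + y * I) := by
  have h1 : s ×ℂ t = measurableEquivRealProd ⁻¹' (s ×ˢ t) := by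
    ext z; simp [mem_reProdIm]
  have hm := volume_preserving_equiv_real_prod
  have hk : h = fun z => (fun p : ℝ × ℝ => h (p.1 + p.2 * I)) (measurableEquivRealProd z) := by
    ext z; simp
  have hi2 : IntegrableOn (fun p : ℝ × ℝ => h (p.1 + p.2 * I)) (s ×ˢ t) volume := by
    rw [h1, hk] at hi
    exact (hm.integrableOn_comp_preimage measurableEquivRealProd.measurableEmbedding).1 hi
  calc ∫ z in s ×ℂ t, h z
      = ∫ z in measurableEquivRealProd ⁻¹' (s ×ˢ t),
          (fun p : ℝ × ℝ => h (p.1 + p.2 * I)) (measurableEquivRealProd z) := by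
        rw [← hk, h1]
    _ = ∫ p in s ×ˢ t, h (p.1 + p.2 * I) :=
        hm.setIntegral_preimage_emb measurableEquivRealProd.measurableEmbedding
          (fun p : ℝ × ℝ => h (p.1 + p.2 * I)) (s ×ˢ t)
    _ = _ := by
        rw [Measure.volume_eq_prod, ← Measure.prod_restrict, integral_prod_symm]
        rw [Measure.prod_restrict, ← Measure.volume_eq_prod]; exact hi2

lemma deriv_cont (h : Hyd K f g) : ContinuousOn (deriv f) UHP :=
  (h.fd.deriv isOpen_UHP).continuousOn

lemma box_energy (h : Hyd K f g) {b R ε : ℝ} (hb : 0 < b) (hR : 0 < R) (hε : 0 < ε) (hεR : ε ≤ R)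
    (hbox : ∀ w ∈ UHP, |w.re| ≤ R → w.im ≤ R →
      |(f w).re| ≤ R + 2 * b / R ∧ (f w).im ≤ R + 2 * b / R)
    (hside : ∀ w ∈ UHP, |w.re| = R → ‖f w - w‖ ≤ b / R) :
    ∫⁻ w in Icc (-R) R ×ℂ Icc ε R, ENNReal.ofReal (‖deriv f w - 1‖ ^ 2)
      ≤ ENNReal.ofReal (12 * b + 8 * b ^ 2 / R ^ 2 + 2 * R * ε) := by
  set B := Icc (-R) R ×ℂ Icc ε R with hB
  have hBc : IsCompact B := isCompact_Icc.reProdIm isCompact_Icc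
  have hBU : B ⊆ UHP := fun w hw => lt_of_lt_of_le hε hw.2.1
  have hdc : ContinuousOn (deriv f) B := h.deriv_cont.mono hBU
  have hBm : MeasurableSet B := hBc.measurableSet
  have hi1 : IntegrableOn (deriv f) B := hdc.integrableOn_compact hBc
  have hi2 : IntegrableOn (fun w => ‖deriv f w‖ ^ 2) B := (hdc.norm.pow 2).integrableOn_compact hBc
  have hi3 : IntegrableOn (fun w => ‖deriv f w - 1‖ ^ 2) B :=
    ((hdc.sub continuousOn_const).norm.pow 2).integrableOn_compact hBc
  have hi4 : IntegrableOn (fun w => (deriv f w - 1)) B :=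
    (hdc.sub continuousOn_const).integrableOn_compact hBc
  rw [← ofReal_integral_eq_lintegral_ofReal hi3 (ae_of_all _ fun _ => by positivity)]
  apply ENNReal.ofReal_le_ofReal
  -- area
  have hvB : volume.real B = 2 * R * (R - ε) := by
    rw [Measure.real, hB, volume_reProdIm, Real.volume_Icc, Real.volume_Icc,
      ← ENNReal.ofReal_mul (by linarith), ENNReal.toReal_ofReal (by nlinarith)]
    ring
  have harea : ∫ w in B, ‖deriv f w‖ ^ 2 ≤ 2 * (R + 2 * b / R) ^ 2 := by
    have h1 : ENNReal.ofReal (∫ w in B, ‖deriv f w‖ ^ 2) = volume (f '' B) := by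
      rw [ofReal_integral_eq_lintegral_ofReal hi2 (ae_of_all _ fun _ => by positivity)]
      rw [← lintegral_abs_det_fderiv_eq_addHaar_image (f' := fun w => deriv f w • (1 : ℂ →L[ℝ] ℂ))
        volume hBm (fun x hx => ((h.fan (hBU hx)).differentiableAt.hasDerivAt.complexToReal_fderiv).hasFDerivWithinAt)
        (h.finj.mono hBU)]
      refine lintegral_congr fun w => ?_
      rw [det_smul_one, abs_of_nonneg (by positivity)]
    have h2 : f '' B ⊆ Icc (-(R + 2 * b / R)) (R + 2 * b / R) ×ℂ Icc 0 (R + 2 * b / R) := by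
      rintro _ ⟨w, hw, rfl⟩
      have h3 := hbox w (hBU hw) (abs_le.2 hw.1) hw.2.2
      exact ⟨abs_le.1 h3.1, (h.f_mem (hBU hw)).1.le, h3.2⟩
    have h3 := measure_mono (μ := volume) h2
    have hpos : 0 ≤ R + 2 * b / R := by positivity
    rw [← h1, volume_reProdIm, Real.volume_Icc, Real.volume_Icc,
      ← ENNReal.ofReal_mul (by linarith), ENNReal.ofReal_le_ofReal_iff (by nlinarith)] at h3
    linarith
  -- linear term
  have hlin : ‖∫ w in B, (deriv f w - 1)‖ ≤ 2 * b := by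
    rw [setIntegral_reProdIm hi4]
    have h1 : ∀ y ∈ Icc ε R, ‖∫ x in Icc (-R) R, (deriv f (x + y * I) - 1)‖ ≤ 2 * b / R := by
      intro y hy
      have hyU : ∀ x : ℝ, (x + y * I : ℂ) ∈ UHP := by
        intro x; rw [mem_UHP]; simp; linarith [hy.1]
      rw [integral_Icc_eq_integral_Ioc, ← intervalIntegral.integral_of_le (by linarith)]
      rw [intervalIntegral.integral_eq_sub_of_hasDerivAt
        (f := fun x : ℝ => f (x + y * I) - (x + y * I))]
      · refine (norm_sub_le _ _).trans ?_
        have h2 := hside _ (hyU R) (by simp [abs_of_pos hR])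
        have h3 := hside _ (hyU (-R)) (by simp [abs_of_pos hR])
        push_cast at h3 ⊢
        calc _ ≤ b / R + b / R := add_le_add h2 h3
          _ = _ := by ring
      · intro x _
        have h2 := (h.fan (hyU x)).differentiableAt.hasDerivAt
        have h3 : HasDerivAt (fun x : ℂ => x + y * I) 1 (x:ℂ) := (hasDerivAt_id _).add_const _
        have h4 := (HasDerivAt.comp (x:ℂ) h2 h3).sub h3
        simpa using h4.comp_ofReal
      · apply ContinuousOn.intervalIntegrable
        refine ContinuousOn.sub ?_ continuousOn_const
        exact h.deriv_cont.comp (by fun_prop) (fun x _ => hyU x)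
    refine (norm_setIntegral_le_of_norm_le_const (by simp) h1).trans ?_
    rw [Measure.real, Real.volume_Icc, ENNReal.toReal_ofReal (by linarith)]
    rw [div_mul_eq_mul_div, div_le_iff₀ hR]
    nlinarith
  have hre : ∫ w in B, (deriv f w - 1).re = (∫ w in B, (deriv f w - 1)).re := integral_re hi4
  have hexp : ∫ w in B, ‖deriv f w - 1‖ ^ 2
      = ∫ w in B, (‖deriv f w‖ ^ 2 - 1 - 2 * (deriv f w - 1).re) := by
    refine integral_congr_ae (ae_of_all _ fun w => ?_)
    simp only [← normSq_eq_norm_sq, normSq_apply, sub_re, sub_im, one_re, one_im]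
    ring
  have hi5 : IntegrableOn (fun w => (deriv f w - 1).re) B := hi4.re
  have hi6 : IntegrableOn (fun _ : ℂ => (1:ℝ)) B := continuousOn_const.integrableOn_compact hBc
  have hi7 : IntegrableOn (fun w => ‖deriv f w‖ ^ 2 - 1) B := hi2.sub hi6
  rw [hexp, integral_sub hi7 (hi5.const_mul 2), integral_sub hi2 hi6, integral_const_mul, hre,
    setIntegral_const, hvB]
  have h5 := (abs_le.1 ((abs_re_le_norm _).trans hlin)).1
  have h6 : 2 * (R + 2 * b / R) ^ 2 = 2 * R ^ 2 + 8 * b + 8 * b ^ 2 / R ^ 2 := by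
    field_simp; ring
  rw [smul_eq_mul, mul_one]
  nlinarith
end Hyd

namespace Hyd
open MeasureTheory
variable {K : Set ℂ} {f g : ℂ → ℂ}

lemma hcap_nonneg (h : Hyd K f g) {a : ℝ} (ha : HasHcap K f a) : 0 ≤ a := by
  have h1 : Tendsto (fun y : ℝ => (y * I : ℂ)) atTop (cobounded ℂ ⊓ 𝓟 UHP) := by
    refine tendsto_inf.2 ⟨?_, ?_⟩
    · rw [← tendsto_norm_atTop_iff_cobounded]
      refine tendsto_id.congr' ?_
      filter_upwards [eventually_ge_atTop 0] with y hy
      simp [abs_of_nonneg hy]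
    · rw [tendsto_principal]
      filter_upwards [eventually_gt_atTop 0] with y hy
      rw [mem_UHP]; simpa using hy
  have h2 := (continuous_re.tendsto _).comp (Tendsto.comp ha h1)
  rw [ofReal_re] at h2
  refine ge_of_tendsto h2 ?_
  filter_upwards [eventually_gt_atTop 0] with y hy
  have h3 := h.im_le (w := (y * I : ℂ)) (by rw [mem_UHP]; simpa using hy)
  simp at h3 ⊢
  nlinarith

lemma far_hcap {a b : ℝ} (ha0 : 0 ≤ a) (hab : a < b) (ha : HasHcap K f a) :
    ∃ R > 0, ∀ w ∈ UHP, R ≤ ‖w‖ → ‖f w - w‖ ≤ b / ‖w‖ := by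
  have h1 : ∀ᶠ z in cobounded ℂ ⊓ 𝓟 UHP, ‖z * (z - f z)‖ < b := by
    refine (Tendsto.norm ha).eventually (Iio_mem_nhds ?_)
    rwa [norm_real, Real.norm_eq_abs, abs_of_nonneg ha0]
  rw [eventually_inf_principal, ← comap_norm_atTop, eventually_comap] at h1
  obtain ⟨R, hR⟩ := eventually_atTop.1 h1
  refine ⟨max R 1, by positivity, fun w hw hwR => ?_⟩
  have h2 := hR ‖w‖ ((le_max_left _ _).trans hwR) w rfl hw
  have h3 : 0 < ‖w‖ := lt_of_lt_of_le (by positivity) hwR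
  rw [norm_mul, norm_sub_rev] at h2
  rw [le_div_iff₀ h3]; linarith

lemma energy_aux (h : Hyd K f g) {a b β C₀ : ℝ} (ha : HasHcap K f a)
    (hH : IsHolder f β C₀) (hab : a < b) (hβ : 0 ≤ β) (hC : 0 ≤ C₀) :
    ∫⁻ w in UHP, ENNReal.ofReal (‖deriv f w - 1‖ ^ 2) ≤ ENNReal.ofReal (12 * b) := by
  have ha0 := h.hcap_nonneg ha
  have hb : 0 < b := by linarith
  obtain ⟨R0, hR0, hfar⟩ := far_hcap ha0 hab ha
  obtain ⟨M, hM⟩ : ∃ M, ∀ w ∈ UHP, ‖w‖ < R0 → ‖f w‖ ≤ M := by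
    refine ⟨‖f I‖ + C₀ * max ((R0 + 1) ^ β) (R0 + 1), fun w hw hwR => ?_⟩
    have h1 := hH w hw I (by simp [mem_UHP])
    have h2 : dist w I ≤ R0 + 1 := by
      rw [dist_eq_norm]
      refine (norm_sub_le _ _).trans ?_
      rw [norm_I]; linarith
    have h3 : dist (f w) (f I) ≤ C₀ * max ((R0 + 1) ^ β) (R0 + 1) := by
      refine h1.trans ?_
      gcongr
    rw [dist_eq_norm] at h3
    have := norm_sub_norm_le (f w) (f I)
    linarith
  set r : ℕ → ℝ := fun n => n + 1 with hr
  have hr1 : ∀ n, 1 ≤ r n := fun n => by simp [hr]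
  have hrm : Monotone r := fun m n hmn => by simp [hr, hmn]
  have hrt : Tendsto r atTop atTop := tendsto_atTop_add_const_right _ _ tendsto_natCast_atTop_atTop
  set B : ℕ → Set ℂ := fun n => Icc (-(r n)) (r n) ×ℂ Icc (1 / r n ^ 2) (r n) with hBd
  have hBm : Monotone B := by
    intro m n hmn w hw
    have h1 := hrm hmn
    have h2 := hr1 m
    refine ⟨⟨by linarith [hw.1.1], by linarith [hw.1.2]⟩, ?_, by linarith [hw.2.2]⟩
    refine le_trans ?_ hw.2.1
    gcongr
  have hBU : UHP = ⋃ n, B n := by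
    ext w
    rw [mem_iUnion]
    constructor
    · intro hw
      have hwi : 0 < w.im := hw
      obtain ⟨n, hn⟩ := (hrt.eventually (eventually_ge_atTop (max ‖w‖ (1 / w.im)))).exists
      have h1 := (le_max_left _ _).trans hn
      have h2 := (le_max_right _ _).trans hn
      have h3 := abs_le.1 ((abs_re_le_norm w).trans h1)
      have h4 := (le_abs_self _).trans ((abs_im_le_norm w).trans h1)
      refine ⟨n, h3, ?_, h4⟩
      rw [div_le_iff₀ hwi] at h2
      have := hr1 n
      rw [div_le_iff₀ (by positivity)]
      nlinarith [mul_pos hwi (by linarith : 0 < r n)]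
    · rintro ⟨n, hn⟩
      have := hr1 n
      have h2 : 0 < 1 / r n ^ 2 := by positivity
      exact lt_of_lt_of_le h2 hn.2.1
  have hlim : Tendsto (fun n => 12 * b + 8 * b ^ 2 / r n ^ 2 + 2 * r n * (1 / r n ^ 2)) atTop
      (nhds (12 * b)) := by
    have h1 : Tendsto (fun n => (r n)⁻¹) atTop (nhds 0) := tendsto_inv_atTop_zero.comp hrt
    have h2 := ((h1.pow 2).const_mul (8 * b ^ 2)).const_add (12 * b) |>.add (h1.const_mul 2)
    simp only [ne_eq, OfNat.ofNat_ne_zero, not_false_eq_true, zero_pow, mul_zero, add_zero] at h2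
    refine h2.congr fun n => ?_
    have : r n ≠ 0 := by have := hr1 n; positivity
    field_simp
  have hkey : ∀ᶠ n in atTop, ∫⁻ w in B n, ENNReal.ofReal (‖deriv f w - 1‖ ^ 2)
      ≤ ENNReal.ofReal (12 * b + 8 * b ^ 2 / r n ^ 2 + 2 * r n * (1 / r n ^ 2)) := by
    filter_upwards [hrt.eventually (eventually_ge_atTop (max M (max (2 * R0) (2 * (b / R0)))))]
      with n hn
    have hn1 := (le_max_left _ _).trans hn
    have hn2 := ((le_max_left _ _).trans (le_max_right _ _)).trans hn
    have hn3 := ((le_max_right _ _).trans (le_max_right _ _)).trans hn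
    have hrn := hr1 n
    have hrp : 0 < r n := by linarith
    refine h.box_energy hb hrp (by positivity) ?_ ?_ ?_
    · rw [div_le_iff₀ (by positivity)]; nlinarith [pow_le_pow_left₀ zero_le_one hrn 3]
    · intro w hw hwr hwi
      have hbr : 0 ≤ 2 * b / r n := by positivity
      suffices hs : ‖f w‖ ≤ r n ∨ ‖f w - w‖ ≤ 2 * b / r n by
        rcases hs with hs | hs
        · exact ⟨by linarith [abs_re_le_norm (f w)],
            by linarith [abs_im_le_norm (f w), le_abs_self (f w).im]⟩
        · have h1 := abs_le.1 ((abs_re_le_norm (f w - w)).trans hs)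
          have h2 := abs_le.1 ((abs_im_le_norm (f w - w)).trans hs)
          rw [sub_re] at h1
          rw [sub_im] at h2
          rw [abs_le] at hwr
          exact ⟨abs_le.2 ⟨by linarith, by linarith⟩, by linarith⟩
      by_cases h1 : ‖w‖ < R0
      · left; exact (hM w hw h1).trans hn1
      push Not at h1
      have h2 := hfar w hw h1
      by_cases h3 : ‖w‖ < r n / 2
      · left
        have h4 : b / ‖w‖ ≤ b / R0 := by gcongr
        have h5 : ‖f w‖ ≤ ‖f w - w‖ + ‖w‖ := by
          have := norm_add_le (f w - w) w
          simpa using this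
        linarith
      · right
        push Not at h3
        refine h2.trans ?_
        have h5 : b / ‖w‖ ≤ b / (r n / 2) := by gcongr
        refine h5.trans (le_of_eq ?_)
        field_simp
    · intro w hw hwr
      have h1 : r n ≤ ‖w‖ := by rw [← hwr]; exact abs_re_le_norm w
      refine (hfar w hw (by linarith)).trans ?_
      gcongr
  rw [hBU, setLIntegral_iUnion_of_directed _ hBm.directed_le]
  refine iSup_le fun n => ?_
  refine ge_of_tendsto ((ENNReal.continuous_ofReal.tendsto _).comp hlim) ?_
  filter_upwards [hkey, eventually_ge_atTop n] with m hm hmn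
  exact (lintegral_mono_set (hBm hmn)).trans hm

lemma energy (h : Hyd K f g) {a β C₀ : ℝ} (ha : HasHcap K f a)
    (hH : IsHolder f β C₀) (hβ : 0 ≤ β) (hC : 0 ≤ C₀) :
    ∫⁻ w in UHP, ENNReal.ofReal (‖deriv f w - 1‖ ^ 2) ≤ ENNReal.ofReal (12 * a) := by
  have h1 : Tendsto (fun b : ℝ => ENNReal.ofReal (12 * b)) (nhdsWithin a (Ioi a))
      (nhds (ENNReal.ofReal (12 * a))) := by
    have : Continuous fun b : ℝ => ENNReal.ofReal (12 * b) :=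
      ENNReal.continuous_ofReal.comp (by fun_prop)
    exact (this.tendsto a).mono_left nhdsWithin_le_nhds
  refine ge_of_tendsto h1 ?_
  filter_upwards [self_mem_nhdsWithin] with b hb
  exact h.energy_aux ha hH hb hβ hC

end Hyd

namespace Hyd
open MeasureTheory
variable {K : Set ℂ} {f g : ℂ → ℂ}

lemma lintegral_polar (x₀ : ℝ) (φ : ℂ → ENNReal) :
    ∫⁻ z, φ z = ∫⁻ p in Ioi (0:ℝ) ×ˢ Ioo (-Real.pi) Real.pi,
      ENNReal.ofReal p.1 * φ (x₀ + p.1 * exp (p.2 * I)) := by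
  rw [← lintegral_add_left_eq_self φ (x₀:ℂ), ← Complex.lintegral_comp_polarCoord_symm]
  refine lintegral_congr fun p => ?_
  rw [Complex.polarCoord_symm_apply, smul_eq_mul, exp_mul_I]
  push_cast
  rfl

lemma annulus_int (xs : ℝ) {r R : ℝ} (hr : 0 < r) (hrR : r ≤ R) :
    ∫⁻ w in {w : ℂ | r ≤ ‖w - xs‖ ∧ ‖w - xs‖ ≤ R}, ENNReal.ofReal (1 / ‖w - xs‖ ^ 2)
      ≤ ENNReal.ofReal (2 * Real.pi * Real.log (R / r)) := by
  have hpi := Real.pi_pos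
  set A : Set ℂ := {w : ℂ | r ≤ ‖w - xs‖ ∧ ‖w - xs‖ ≤ R} with hA
  have hAm : MeasurableSet A := by
    apply IsClosed.measurableSet
    have hc : Continuous fun w : ℂ => ‖w - xs‖ := by fun_prop
    exact (isClosed_le continuous_const hc).inter
      (isClosed_le hc continuous_const)
  rw [← lintegral_indicator hAm, lintegral_polar xs]
  have hn : ∀ p ∈ Ioi (0:ℝ) ×ˢ Ioo (-Real.pi) Real.pi,
      ‖(xs + (p.1:ℝ) * exp ((p.2:ℝ) * I) - xs : ℂ)‖ = p.1 := by
    rintro ⟨s, θ⟩ ⟨hs, -⟩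
    simp only [add_sub_cancel_left]
    rw [norm_mul, norm_exp_ofReal_mul_I, norm_real, Real.norm_eq_abs, abs_of_pos hs, mul_one]
  calc _ = ∫⁻ p in Ioi (0:ℝ) ×ˢ Ioo (-Real.pi) Real.pi,
        (Icc r R).indicator (fun s => ENNReal.ofReal (1 / s)) p.1 * 1 := by
        refine setLIntegral_congr_fun (measurableSet_Ioi.prod measurableSet_Ioo) fun p hp => ?_
        have h1 := hn p hp
        have hp1 : 0 < p.1 := hp.1
        by_cases h2 : p.1 ∈ Icc r R
        · rw [indicator_of_mem h2, indicator_of_mem (by rw [hA, mem_ofPred_eq, h1]; exact h2), h1,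
            ← ENNReal.ofReal_mul hp1.le, mul_one]
          congr 1
          field_simp
        · rw [indicator_of_notMem h2, indicator_of_notMem (by rw [hA, mem_ofPred_eq, h1]; exact h2)]
          simp
    _ ≤ (∫⁻ s in Icc r R, ENNReal.ofReal (1 / s)) * ENNReal.ofReal (2 * Real.pi) := by
        rw [Measure.volume_eq_prod, ← Measure.prod_restrict,
          lintegral_prod_mul (f := (Icc r R).indicator (fun s => ENNReal.ofReal (1 / s)))
            (g := fun _ => 1) ?_ (by fun_prop)]
        · refine mul_le_mul' ?_ ?_
          · refine (setLIntegral_le_lintegral _ _).trans ?_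
            rw [lintegral_indicator measurableSet_Icc]
          · rw [lintegral_one, Measure.restrict_apply_univ, Real.volume_Ioo]
            apply le_of_eq
            congr 1; ring
        · refine Measurable.aemeasurable ?_
          refine Measurable.indicator ?_ measurableSet_Icc
          fun_prop
    _ = _ := by
        have hi : IntegrableOn (fun s : ℝ => 1 / s) (Icc r R) := by
          apply ContinuousOn.integrableOn_compact isCompact_Icc
          refine continuousOn_const.div continuousOn_id fun s hs => ?_
          exact (lt_of_lt_of_le hr hs.1).ne'
        rw [← ofReal_integral_eq_lintegral_ofReal hi, ← ENNReal.ofReal_mul', mul_comm]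
        · congr 2
          rw [integral_Icc_eq_integral_Ioc, ← intervalIntegral.integral_of_le hrR,
            integral_one_div_of_pos hr (by linarith)]
        · positivity
        · filter_upwards [ae_restrict_mem measurableSet_Icc] with s hs
          have : 0 < s := lt_of_lt_of_le hr hs.1
          simp only [Pi.zero_apply]
          positivity

lemma polar_markov (x₀ : ℝ) {r1 r2 : ℝ} (hr1 : 0 ≤ r1) {φ : ℂ → ENNReal} (hφ : Measurable φ)
    {P : Set ℝ} (hP : P ⊆ Ioo r1 r2)
    (h : ∀ s ∈ P, ENNReal.ofReal (1 / 2) ≤ ∫⁻ θ in Ioo (-Real.pi) Real.pi,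
      ENNReal.ofReal s * φ (x₀ + s * exp (θ * I))) :
    ENNReal.ofReal (1 / 2) * volume P ≤ ∫⁻ z in {z : ℂ | r1 < ‖z - x₀‖ ∧ ‖z - x₀‖ < r2}, φ z := by
  set A : Set ℂ := {z : ℂ | r1 < ‖z - x₀‖ ∧ ‖z - x₀‖ < r2} with hA
  have hAm : MeasurableSet A := by
    apply IsOpen.measurableSet
    have hc : Continuous fun w : ℂ => ‖w - x₀‖ := by fun_prop
    exact (isOpen_lt continuous_const hc).inter
      (isOpen_lt hc continuous_const)
  have hn : ∀ p ∈ Ioo r1 r2 ×ˢ Ioo (-Real.pi) Real.pi,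
      ‖(x₀ + (p.1:ℝ) * exp ((p.2:ℝ) * I) - x₀ : ℂ)‖ = p.1 := by
    rintro ⟨s, θ⟩ ⟨hs, -⟩
    simp only [add_sub_cancel_left]
    rw [norm_mul, norm_exp_ofReal_mul_I, norm_real, Real.norm_eq_abs,
      abs_of_pos (lt_of_le_of_lt hr1 hs.1), mul_one]
  set F : ℝ × ℝ → ENNReal := fun p => ENNReal.ofReal p.1 * φ (x₀ + p.1 * exp (p.2 * I)) with hF
  have hFm : Measurable F := by
    refine Measurable.mul (by fun_prop) (hφ.comp ?_)
    apply Continuous.measurable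
    fun_prop
  have hΦ : Measurable fun s : ℝ => ∫⁻ θ in Ioo (-Real.pi) Real.pi, F (s, θ) :=
    hFm.lintegral_prod_right'
  rw [← lintegral_indicator hAm, lintegral_polar x₀]
  calc _ ≤ ENNReal.ofReal (1/2) * (volume.restrict (Ioo r1 r2))
          {s | ENNReal.ofReal (1/2) ≤ ∫⁻ θ in Ioo (-Real.pi) Real.pi, F (s, θ)} := by
        refine mul_le_mul_right ?_ _
        rw [Measure.restrict_apply' measurableSet_Ioo]
        exact measure_mono fun s hs => ⟨h s hs, hP hs⟩
    _ ≤ ∫⁻ s in Ioo r1 r2, ∫⁻ θ in Ioo (-Real.pi) Real.pi, F (s, θ) :=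
        mul_meas_ge_le_lintegral hΦ _
    _ = ∫⁻ p in Ioo r1 r2 ×ˢ Ioo (-Real.pi) Real.pi, F p := by
        rw [Measure.volume_eq_prod, ← Measure.prod_restrict, lintegral_prod _ hFm.aemeasurable]
    _ = ∫⁻ p in Ioo r1 r2 ×ˢ Ioo (-Real.pi) Real.pi,
          ENNReal.ofReal p.1 * A.indicator φ (x₀ + p.1 * exp (p.2 * I)) := by
        refine setLIntegral_congr_fun (measurableSet_Ioo.prod measurableSet_Ioo) fun p hp => ?_
        have h1 := hn p hp
        rw [indicator_of_mem (by rw [hA, mem_ofPred_eq, h1]; exact hp.1)]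
    _ ≤ _ := by
        apply lintegral_mono_set
        exact prod_mono (fun s hs => lt_of_le_of_lt hr1 hs.1) subset_rfl

end Hyd

namespace Hyd
open MeasureTheory
variable {K : Set ℂ} {f g : ℂ → ℂ}

lemma first_hit (h : Hyd K f g) {x₀ s : ℝ} (hKc : IsClosed (insert (x₀:ℂ) K)) (hs : 0 < s)
    {z : ℂ} (hz : z ∈ K) (hzs : ‖z - x₀‖ = s) (hzr : x₀ ≤ z.re) :
    ∃ θ₀, 0 < θ₀ ∧ θ₀ ≤ Real.pi / 2 ∧ (∀ θ ∈ Ioo 0 θ₀, (x₀ + s * exp (θ * I) : ℂ) ∉ K) ∧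
      (x₀ + s * exp (θ₀ * I) : ℂ) ∈ K := by
  set p : ℝ → ℂ := fun θ => x₀ + s * exp (θ * I) with hp
  have hpc : Continuous p := by fun_prop
  have hpn : ∀ θ, ‖p θ - x₀‖ = s := by
    intro θ
    simp only [hp, add_sub_cancel_left]
    rw [norm_mul, norm_exp_ofReal_mul_I, norm_real, Real.norm_eq_abs, abs_of_pos hs, mul_one]
  set T : Set ℝ := Icc 0 (Real.pi / 2) ∩ p ⁻¹' (insert (x₀:ℂ) K) with hT
  have hTc : IsCompact T := isCompact_Icc.inter_right (hKc.preimage hpc)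
  have hTne : T.Nonempty := by
    refine ⟨arg (z - x₀), ⟨?_, ?_⟩, ?_⟩
    · rw [arg_nonneg_iff]
      have : 0 < z.im := h.hKU hz
      simp; linarith
    · have := abs_arg_le_pi_div_two_iff.2 (show 0 ≤ (z - x₀).re by simp; linarith)
      exact (le_abs_self _).trans this
    · right
      have h1 : p (arg (z - x₀)) = z := by
        simp only [hp]
        rw [← hzs, norm_mul_exp_arg_mul_I]; ring
      rw [h1]; exact hz
  have hmem := hTc.sInf_mem hTne
  have hpK : p (sInf T) ∈ K := by
    rcases hmem.2 with h1 | h1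
    · exfalso
      have := hpn (sInf T)
      rw [h1, sub_self, norm_zero] at this
      linarith
    · exact h1
  refine ⟨sInf T, ?_, hmem.1.2, ?_, hpK⟩
  · refine lt_of_le_of_ne hmem.1.1 fun h0 => ?_
    rw [← h0] at hpK
    have : 0 < (p 0).im := h.hKU hpK
    simp [hp] at this
  · intro θ hθ hK
    have : sInf T ≤ θ := csInf_le hTc.bddBelow ⟨⟨hθ.1.le, by linarith [hθ.2, hmem.1.2]⟩, Or.inr hK⟩
    linarith [hθ.2]

lemma exists_bdry (h : Hyd K f g) {x₀ ρ : ℝ} (hρ : 0 < ρ) (hK : K ⊆ closedBall (x₀ : ℂ) ρ)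
    {fb : ℂ → ℂ} (hfb : ∀ x : ℂ, 0 ≤ x.im → Tendsto f (nhdsWithin x UHP) (nhds (fb x)))
    {s θ₀ : ℝ} (hs : 0 < s) (hsρ : s < 2 * ρ) (hθ : 0 < θ₀) (hθ2 : θ₀ ≤ Real.pi / 2)
    (hout : ∀ θ ∈ Ioo 0 θ₀, (x₀ + s * exp (θ * I) : ℂ) ∉ K)
    (hin : (x₀ + s * exp (θ₀ * I) : ℂ) ∈ K) : ∃ x : ℝ, fb x ∈ K := by
  have hpi := Real.pi_gt_three
  obtain ⟨c, hR⟩ := h.R_bound hρ hK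
  set p : ℝ → ℂ := fun θ => x₀ + s * exp (θ * I) with hp
  have hpc : Continuous p := by fun_prop
  have hpim : ∀ θ, (p θ).im = s * Real.sin θ := by
    intro θ; simp [hp, exp_im, exp_re]
  have hpn : ∀ θ, ‖p θ - x₀‖ = s := by
    intro θ
    simp only [hp, add_sub_cancel_left]
    rw [norm_mul, norm_exp_ofReal_mul_I, norm_real, Real.norm_eq_abs, abs_of_pos hs, mul_one]
  have hpU : ∀ θ ∈ Ioo 0 θ₀, p θ ∈ UHP \ K := by
    intro θ hθ'
    refine ⟨?_, hout θ hθ'⟩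
    rw [mem_UHP, hpim]
    exact mul_pos hs (Real.sin_pos_of_pos_of_lt_pi hθ'.1 (by linarith [hθ'.2]))
  set u : ℕ → ℝ := fun n => θ₀ - θ₀ / 2 / (n + 1) with hu
  have hu1 : ∀ n, u n ∈ Ico (θ₀ / 2) θ₀ := by
    intro n
    have h1 : θ₀ / 2 / ((n:ℝ) + 1) ≤ θ₀ / 2 := div_le_self (half_pos hθ).le (by linarith [n.cast_nonneg (α := ℝ)])
    have h2 : 0 < θ₀ / 2 / ((n:ℝ) + 1) := by positivity
    exact ⟨by simp only [hu]; linarith, by simp only [hu]; linarith⟩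
  have hu2 : Tendsto u atTop (nhds θ₀) := by
    have h1 : Tendsto (fun n : ℕ => θ₀ / 2 * (1 / ((n:ℝ) + 1))) atTop (nhds (θ₀ / 2 * 0)) :=
      tendsto_one_div_add_atTop_nhds_zero_nat.const_mul _
    have h2 := h1.const_sub θ₀
    simp only [mul_zero, sub_zero] at h2
    refine h2.congr fun n => ?_
    simp only [hu]; ring
  have hu3 : ∀ n, u n ∈ Ioo 0 θ₀ := fun n => ⟨by linarith [(hu1 n).1], (hu1 n).2⟩
  have hbd : ∀ n, g (p (u n)) ∈ closedBall (c:ℂ) (28 * ρ) := by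
    intro n
    rw [mem_closedBall, dist_eq_norm]
    refine hR _ (h.g_mem (hpU _ (hu3 n))) ?_
    rw [h.fg (hpU _ (hu3 n)), hpn]; exact hsρ
  obtain ⟨wl, -, φ, hφ, hwl⟩ := (isCompact_closedBall (c:ℂ) (28 * ρ)).tendsto_subseq hbd
  have hwlim : 0 ≤ wl.im := by
    refine ge_of_tendsto ((continuous_im.tendsto _).comp hwl) (Eventually.of_forall fun n => ?_)
    exact le_of_lt (h.g_mem (hpU _ (hu3 (φ n))))
  have hwlU : Tendsto ((fun n => g (p (u n))) ∘ φ) atTop (nhdsWithin wl UHP) :=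
    tendsto_nhdsWithin_iff.2 ⟨hwl, Eventually.of_forall fun n => h.g_mem (hpU _ (hu3 (φ n)))⟩
  have hfwl : fb wl = p θ₀ := by
    have h1 := (hfb wl hwlim).comp hwlU
    have h2 : Tendsto (fun n => p (u (φ n))) atTop (nhds (p θ₀)) :=
      (hpc.tendsto _).comp (hu2.comp hφ.tendsto_atTop)
    refine tendsto_nhds_unique (h1.congr fun n => ?_) h2
    exact h.fg (hpU _ (hu3 (φ n)))
  have hwl0 : wl.im = 0 := by
    by_contra hne
    have hwU : wl ∈ UHP := lt_of_le_of_ne hwlim (Ne.symm hne)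
    have h1 := hfb wl hwlim
    have := neBot hwlim
    have h2 : Tendsto f (nhdsWithin wl UHP) (nhds (f wl)) :=
      (h.fan hwU).continuousAt.tendsto.mono_left nhdsWithin_le_nhds
    have h3 := tendsto_nhds_unique h1 h2
    have h4 := (h.f_mem hwU).2
    rw [← h3, hfwl] at h4
    exact h4 hin
  have hwlr : wl = (wl.re : ℂ) := Complex.ext (by simp) (by simp [hwl0])
  exact ⟨wl.re, by rw [← hwlr, hfwl]; exact hin⟩

lemma dens_contOn (h : Hyd K f g) (xs lam : ℝ) : ContinuousOn (dens g xs lam) (UHP \ K) := by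
  have h1 : ContinuousOn (deriv g) (UHP \ K) := (h.g_diffOn.deriv h.hopen).continuousOn
  have h2 : ContinuousOn g (UHP \ K) := h.g_diffOn.continuousOn
  have h3 : ∀ z ∈ UHP \ K, g z - xs ≠ 0 := by
    intro z hz h0
    have h4 : 0 < (g z).im := h.g_mem hz
    have := congrArg Complex.im h0
    simp at this
    linarith
  unfold dens
  exact (continuousOn_const.mul ((h1.div (h2.sub continuousOn_const) h3).norm.pow 2)).add
    (((continuousOn_const.sub h1).norm.pow 2).div_const _)

lemma dens_nonneg {xs lam : ℝ} (hlam : 0 < lam) (z : ℂ) : 0 ≤ dens g xs lam z := by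
  unfold dens; positivity

lemma dens_energy (h : Hyd K f g) {x₀ xs lam r R r1 r2 a : ℝ} (hlam : 0 < lam)
    (hr : 0 < r) (hrR : r ≤ R)
    (hW : ∀ w ∈ UHP, r1 < ‖f w - x₀‖ → ‖f w - x₀‖ < r2 → r ≤ ‖w - xs‖ ∧ ‖w - xs‖ ≤ R)
    (hE : ∫⁻ w in UHP, ENNReal.ofReal (‖deriv f w - 1‖ ^ 2) ≤ ENNReal.ofReal (12 * a)) :
    ∫⁻ z in {z : ℂ | r1 < ‖z - x₀‖ ∧ ‖z - x₀‖ < r2},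
      (UHP \ K).indicator (fun z => ENNReal.ofReal (dens g xs lam z)) z
    ≤ ENNReal.ofReal lam * ENNReal.ofReal (2 * Real.pi * Real.log (R / r)) +
      ENNReal.ofReal (1 / lam) * ENNReal.ofReal (12 * a) := by
  set A : Set ℂ := {z : ℂ | r1 < ‖z - x₀‖ ∧ ‖z - x₀‖ < r2} with hA
  have hAo : IsOpen A := by
    have hc : Continuous fun w : ℂ => ‖w - x₀‖ := by fun_prop
    exact (isOpen_lt continuous_const hc).inter (isOpen_lt hc continuous_const)
  set W : Set ℂ := UHP ∩ f ⁻¹' A with hWd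
  have hWo : IsOpen W := h.fd.continuousOn.isOpen_inter_preimage isOpen_UHP hAo
  have hfW : A ∩ (UHP \ K) = f '' W := by
    rw [← h.fim, hWd, inter_comm, image_inter_preimage]
  rw [setLIntegral_indicator h.hopen.measurableSet, inter_comm, hfW,
    lintegral_image_eq_lintegral_abs_det_fderiv_mul (f' := fun w => deriv f w • (1 : ℂ →L[ℝ] ℂ))
        volume hWo.measurableSet
        (fun x hx => ((h.fan hx.1).differentiableAt.hasDerivAt.complexToReal_fderiv).hasFDerivWithinAt)
        (h.finj.mono inter_subset_left)]
  calc _ = ∫⁻ w in W, (ENNReal.ofReal lam * ENNReal.ofReal (1 / ‖w - xs‖ ^ 2) +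
        ENNReal.ofReal (1 / lam) * ENNReal.ofReal (‖deriv f w - 1‖ ^ 2)) := by
        refine setLIntegral_congr_fun hWo.measurableSet fun w hw => ?_
        have hd := h.deriv_mul hw.1
        have hd0 : deriv f w ≠ 0 := right_ne_zero_of_mul_eq_one hd
        have hg : deriv g (f w) = (deriv f w)⁻¹ := eq_inv_of_mul_eq_one_left hd
        rw [det_smul_one, abs_of_nonneg (by positivity), ← ENNReal.ofReal_mul (by positivity),
          ← ENNReal.ofReal_mul (by positivity), ← ENNReal.ofReal_mul (by positivity),
          ← ENNReal.ofReal_add (by positivity) (by positivity)]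
        congr 1
        unfold dens
        rw [hg, h.gf hw.1]
        have h1 : ‖deriv f w - 1‖ = ‖deriv f w‖ * ‖1 - (deriv f w)⁻¹‖ := by
          rw [← norm_mul]; congr 1; field_simp
        rw [h1, norm_div, norm_inv]
        have : ‖deriv f w‖ ≠ 0 := norm_ne_zero_iff.2 hd0
        field_simp
    _ = ENNReal.ofReal lam * (∫⁻ w in W, ENNReal.ofReal (1 / ‖w - xs‖ ^ 2)) +
        ENNReal.ofReal (1 / lam) * (∫⁻ w in W, ENNReal.ofReal (‖deriv f w - 1‖ ^ 2)) := by
        rw [lintegral_add_left, lintegral_const_mul', lintegral_const_mul']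
        · exact ENNReal.ofReal_ne_top
        · exact ENNReal.ofReal_ne_top
        · refine Measurable.const_mul ?_ _
          refine ENNReal.measurable_ofReal.comp ?_
          fun_prop
    _ ≤ _ := by
        gcongr
        · refine (lintegral_mono_set ?_).trans (annulus_int xs hr hrR)
          intro w hw
          exact hW w hw.1 hw.2.1 hw.2.2
        · exact (lintegral_mono_set inter_subset_left).trans hE

end Hyd

namespace Hyd
open MeasureTheory
variable {K : Set ℂ} {f g : ℂ → ℂ}

lemma posLog_nonneg (x : ℝ) : 0 ≤ posLog x := le_max_right _ _

lemma log_bound {β C₀ ρ : ℝ} (hβ : 0 < β) (hβ1 : β ≤ 1) (hC : 0 < C₀) (hρ : 0 < ρ) :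
    Real.log (56 * ρ / min (ρ / (2 * C₀)) (min ((ρ / (2 * C₀)) ^ (1 / β)) (56 * ρ))) ≤
      (Real.log 112 + |Real.log C₀| + Real.log 56 + |Real.log (2 * C₀)| / β + 1 / β) *
        (1 + posLog (1 / ρ)) := by
  have hP := posLog_nonneg (1 / ρ)
  have h112 : 0 < Real.log 112 := Real.log_pos (by norm_num)
  have h56 : 0 < Real.log 56 := Real.log_pos (by norm_num)
  have hA : 0 ≤ |Real.log (2 * C₀)| / β := by positivity
  have hB : 0 ≤ 1 / β := by positivity
  have hA2 := abs_nonneg (Real.log C₀)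
  set Q := Real.log 112 + |Real.log C₀| + Real.log 56 + |Real.log (2 * C₀)| / β with hQ
  suffices hs : Real.log (56 * ρ / min (ρ / (2 * C₀)) (min ((ρ / (2 * C₀)) ^ (1 / β)) (56 * ρ)))
      ≤ Q + 1 / β * posLog (1 / ρ) by
    nlinarith [mul_nonneg (show 0 ≤ Q by positivity) hP]
  have hq : 0 < ρ / (2 * C₀) := by positivity
  rcases min_choice (ρ / (2 * C₀)) (min ((ρ / (2 * C₀)) ^ (1 / β)) (56 * ρ)) with h1 | h1
  · rw [h1, show 56 * ρ / (ρ / (2 * C₀)) = 112 * C₀ by field_simp; norm_num,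
      Real.log_mul (by norm_num) hC.ne']
    have := le_abs_self (Real.log C₀)
    nlinarith
  rw [h1]
  rcases min_choice ((ρ / (2 * C₀)) ^ (1 / β)) (56 * ρ) with h2 | h2
  · rw [h2, Real.log_div (by positivity) (by positivity), Real.log_mul (by norm_num) hρ.ne',
      Real.log_rpow hq, Real.log_div hρ.ne' (by positivity)]
    have h3 : -Real.log ρ ≤ posLog (1 / ρ) := by
      unfold posLog
      rw [one_div, Real.log_inv]; exact le_max_left _ _
    have h4 := le_abs_self (Real.log (2 * C₀))
    have h5 : 1 / β * Real.log (2 * C₀) ≤ |Real.log (2 * C₀)| / β := by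
      rw [div_mul_eq_mul_div, one_mul]; gcongr
    have h6 : 1 ≤ 1 / β := by rw [le_div_iff₀ hβ]; linarith
    have h7 : (1 / β - 1) * (-Real.log ρ) ≤ (1 / β - 1) * posLog (1 / ρ) :=
      mul_le_mul_of_nonneg_left h3 (by linarith)
    nlinarith
  · rw [h2, div_self (by positivity), Real.log_one]
    positivity

/-- radii hit by the hull on the right-hand side -/
def hitR (K : Set ℂ) (x₀ ρ : ℝ) : Set ℝ :=
  {s | s ∈ Ioo (ρ / 2) ρ ∧ ∃ z ∈ K, ‖z - x₀‖ = s ∧ x₀ ≤ z.re}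

lemma one_sided {β C₀ : ℝ} (hβ : 0 < β) (hβ1 : β ≤ 1) (hC : 0 < C₀) :
    ∃ C1 > 0, ∀ (K : Set ℂ) (f g : ℂ → ℂ) (x₀ ρ a : ℝ), Hyd K f g → 0 < ρ →
      K ⊆ closedBall (x₀ : ℂ) ρ → IsClosed (insert (x₀:ℂ) K) → HasHcap K f a →
      IsHolder f β C₀ →
      (volume.real (hitR K x₀ ρ)) ^ 2 ≤ C1 * (a * (1 + posLog (1 / ρ))) := by
  set Q := Real.log 112 + |Real.log C₀| + Real.log 56 + |Real.log (2 * C₀)| / β + 1 / β with hQ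
  have hQ0 : 0 < Q := by
    have h112 : 0 < Real.log 112 := Real.log_pos (by norm_num)
    have h56 : 0 < Real.log 56 := Real.log_pos (by norm_num)
    positivity
  have hpi := Real.pi_pos
  refine ⟨384 * Real.pi * Q, by positivity, ?_⟩
  intro K f g x₀ ρ a h hρ hK hKc ha hH
  have ha0 := h.hcap_nonneg ha
  have hP := posLog_nonneg (1 / ρ)
  rcases (hitR K x₀ ρ).eq_empty_or_nonempty with hem | ⟨s0, hs0⟩
  · rw [hem, measureReal_empty, zero_pow two_ne_zero]; positivity
  obtain ⟨fb, hfb⟩ := exists_ext hβ hH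
  have hne : ∃ x : ℝ, fb x ∈ K := by
    obtain ⟨hs1, z, hz, hzs, hzr⟩ := hs0
    have hsp : 0 < s0 := by linarith [hs1.1]
    obtain ⟨θ₀, h1, h2, h3, h4⟩ := h.first_hit hKc hsp hz hzs hzr
    exact h.exists_bdry hρ hK hfb hsp (by linarith [hs1.2]) h1 h2 h3 h4
  obtain ⟨xs, hxs, hxK, hxr, hR⟩ := h.exists_xstar hρ hK hKc hβ hH hfb hne
  set q := ρ / (2 * C₀) with hq
  have hq0 : 0 < q := by positivity
  set r := min q (min (q ^ (1 / β)) (56 * ρ)) with hr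
  have hr0 : 0 < r := by positivity
  have hrR : r ≤ 56 * ρ := (min_le_right _ _).trans (min_le_right _ _)
  set L := 2 * Real.pi * Real.log (56 * ρ / r) with hL
  have hL0 : 0 ≤ L := by
    have : 0 ≤ Real.log (56 * ρ / r) := Real.log_nonneg (by rw [le_div_iff₀ hr0]; linarith)
    positivity
  have hLb : L ≤ 2 * Real.pi * (Q * (1 + posLog (1 / ρ))) := by
    exact mul_le_mul_of_nonneg_left (log_bound hβ hβ1 hC hρ) (by positivity)
  have hW : ∀ w ∈ UHP, ρ / 2 < ‖f w - x₀‖ → ‖f w - x₀‖ < ρ →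
      r ≤ ‖w - xs‖ ∧ ‖w - xs‖ ≤ 56 * ρ := by
    intro w hw h1 h2
    refine ⟨?_, hR w hw (by linarith)⟩
    by_contra hlt
    push Not at hlt
    have h3 := holder_lim hβ hH (x := (xs:ℂ)) (by simp) (hfb xs (by simp)) hw
    rw [hxs] at h3
    have h4 : ‖w - xs‖ < q := hlt.trans_le (min_le_left _ _)
    have h5 : ‖w - xs‖ ^ β < q := by
      have h6 : ‖w - xs‖ < q ^ (1 / β) := hlt.trans_le ((min_le_right _ _).trans (min_le_left _ _))
      have h7 := Real.rpow_lt_rpow (norm_nonneg _) h6 hβ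
      rwa [← Real.rpow_mul hq0.le, one_div_mul_cancel hβ.ne', Real.rpow_one] at h7
    have h6 : C₀ * max (‖w - xs‖ ^ β) ‖w - xs‖ < C₀ * q :=
      mul_lt_mul_of_pos_left (max_lt h5 h4) hC
    have h7 : C₀ * q = ρ / 2 := by rw [hq]; field_simp
    linarith
  have hE := h.energy ha hH hβ.le hC.le
  set v := volume.real (hitR K x₀ ρ) with hv
  have hv0 : 0 ≤ v := measureReal_nonneg
  have hvtop : volume (hitR K x₀ ρ) ≠ ⊤ := by
    refine ne_top_of_le_ne_top (b := volume (Ioo (ρ/2) ρ)) (by simp) (measure_mono fun s hs => hs.1)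
  have key : ∀ lam : ℝ, 0 < lam → v ≤ 2 * (lam * L + 1 / lam * (12 * a)) := by
    intro lam hlam
    set φ : ℂ → ENNReal := (UHP \ K).indicator (fun z => ENNReal.ofReal (dens g xs lam z)) with hφ
    have hφm : Measurable φ := by
      have h1 := h.dens_contOn xs lam
      have h2 : ContinuousOn (fun z => ENNReal.ofReal (dens g xs lam z)) (UHP \ K) :=
        ENNReal.continuous_ofReal.comp_continuousOn h1
      classical
      have h3 := ContinuousOn.measurable_piecewise h2 (continuousOn_const (c := (0:ENNReal)))
        h.hopen.measurableSet
      rw [hφ]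
      convert h3 using 1
      exact (piecewise_eq_indicator (s := UHP \ K)).symm
    have h1 := polar_markov x₀ (r1 := ρ / 2) (r2 := ρ) (by positivity) hφm
      (P := hitR K x₀ ρ) (fun s hs => hs.1) ?_
    · have h2 := h1.trans (h.dens_energy hlam hr0 hrR hW hE)
      rw [← ENNReal.ofReal_mul hlam.le, ← ENNReal.ofReal_mul (by positivity),
        ← ENNReal.ofReal_add (by positivity) (by positivity), ← ENNReal.ofReal_toReal hvtop,
        ← ENNReal.ofReal_mul (by positivity), ENNReal.ofReal_le_ofReal_iff (by positivity)] at h2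
      have h3 : (volume (hitR K x₀ ρ)).toReal = v := rfl
      rw [h3] at h2
      linarith
    · intro s hs
      obtain ⟨hs1, z, hz, hzs, hzr⟩ := hs
      have hsp : 0 < s := by linarith [hs1.1]
      obtain ⟨θ₀, k1, k2, k3, k4⟩ := h.first_hit hKc hsp hz hzs hzr
      obtain ⟨θ₁, θ₂, m1, m2, m3, m4, m5, m6⟩ := h.slice hKc hfb hxK hxr hR hsp
        (by linarith [hs1.2]) k1 k2 hlam k3 k4
      have m7 : IntegrableOn (fun θ : ℝ => s * dens g xs lam (x₀ + s * exp (θ * I))) (Ioc θ₁ θ₂) :=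
        ((continuousOn_const.mul m5).integrableOn_compact isCompact_Icc).mono_set Ioc_subset_Icc_self
      rw [intervalIntegral.integral_of_le m2] at m6
      refine (ENNReal.ofReal_le_ofReal m6).trans ?_
      rw [ofReal_integral_eq_lintegral_ofReal m7
        (ae_of_all _ fun θ => mul_nonneg hsp.le (dens_nonneg hlam _))]
      calc _ = ∫⁻ θ in Ioc θ₁ θ₂, ENNReal.ofReal s * φ (x₀ + s * exp (θ * I)) := by
            refine setLIntegral_congr_fun measurableSet_Ioc fun θ hθ => ?_
            rw [hφ, indicator_of_mem (m4 θ (Ioc_subset_Icc_self hθ)), ENNReal.ofReal_mul hsp.le]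
        _ ≤ _ := by
            apply lintegral_mono_set
            intro θ hθ
            exact ⟨by linarith [hθ.1], by linarith [hθ.2]⟩
  have hdisc : v ^ 2 ≤ 192 * L * a := by
    have h1 := discrim_le_zero (a := 2 * L) (b := -v) (c := 24 * a) (fun x => by
      rcases le_or_gt x 0 with hx | hx
      · nlinarith [mul_nonneg hL0 (mul_self_nonneg x), mul_nonneg hv0 (neg_nonneg.2 hx)]
      · have h2 := mul_le_mul_of_nonneg_left (key x hx) hx.le
        have h3 : x * (2 * (x * L + 1 / x * (12 * a))) = 2 * L * (x * x) + 24 * a := by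
          field_simp; ring
        rw [h3] at h2
        linarith)
    unfold discrim at h1
    nlinarith
  calc v ^ 2 ≤ 192 * L * a := hdisc
    _ ≤ 192 * (2 * Real.pi * (Q * (1 + posLog (1 / ρ)))) * a := by gcongr
    _ = _ := by ring

end Hyd

namespace Hyd
open MeasureTheory
variable {K : Set ℂ} {f g : ℂ → ℂ}

/-- reflection in the imaginary axis -/
def refl (z : ℂ) : ℂ := -(starRingEnd ℂ) z

lemma refl_refl (z : ℂ) : refl (refl z) = z := by simp [refl]

lemma refl_mem {z : ℂ} : refl z ∈ UHP ↔ z ∈ UHP := by simp [refl, mem_UHP]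

lemma refl_cont : Continuous refl := by unfold refl; exact (continuous_conj).neg

lemma refl_sub (z w : ℂ) : refl z - refl w = refl (z - w) := by simp [refl]; ring

lemma refl_norm (z : ℂ) : ‖refl z‖ = ‖z‖ := by simp [refl]

lemma refl_dist (z w : ℂ) : dist (refl z) (refl w) = dist z w := by
  rw [dist_eq_norm, dist_eq_norm, refl_sub, refl_norm]

lemma refl_ofReal (x : ℝ) : refl x = ((-x : ℝ) : ℂ) := by simp [refl]

lemma refl_inj : Injective refl := fun a b hab => by
  rw [← refl_refl a, hab, refl_refl]

lemma refl_tendsto : Tendsto refl (cobounded ℂ ⊓ 𝓟 UHP) (cobounded ℂ ⊓ 𝓟 UHP) := by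
  refine tendsto_inf.2 ⟨?_, ?_⟩
  · rw [← tendsto_norm_atTop_iff_cobounded]
    simp only [refl_norm]
    exact tendsto_norm_cobounded_atTop.mono_left inf_le_left
  · rw [tendsto_principal]
    filter_upwards [mem_inf_of_right (mem_principal_self UHP)] with z hz
    exact refl_mem.2 hz

lemma reflect (h : Hyd K f g) : Hyd (refl ⁻¹' K) (fun w => refl (f (refl w)))
    (invFunOn (fun w => refl (f (refl w))) UHP) where
  hKU := fun z hz => refl_mem.1 (h.hKU hz)
  hopen := by
    have : UHP \ refl ⁻¹' K = refl ⁻¹' (UHP \ K) := by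
      ext z; simp [refl_mem]
    rw [this]; exact h.hopen.preimage refl_cont
  fd := by
    intro w hw
    have h1 : DifferentiableAt ℂ f (refl w) := (h.fan (refl_mem.2 hw)).differentiableAt
    have h2 : DifferentiableAt ℂ (fun u => f (-u)) ((starRingEnd ℂ) w) :=
      DifferentiableAt.comp ((starRingEnd ℂ) w) (f := fun u : ℂ => -u) h1 differentiableAt_id.neg
    have h3 := h2.star_star
    simp only [starRingEnd_apply, star_star] at h3
    exact h3.neg.differentiableWithinAt
  finj := by
    intro a ha b hb hab
    exact refl_inj (h.finj (refl_mem.2 ha) (refl_mem.2 hb) (refl_inj hab))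
  fim := by
    ext z
    constructor
    · rintro ⟨w, hw, rfl⟩
      have := h.f_mem (refl_mem.2 hw)
      exact ⟨refl_mem.2 this.1, by simpa [refl_refl] using this.2⟩
    · rintro ⟨hz1, hz2⟩
      have h1 : refl z ∈ UHP \ K := ⟨refl_mem.2 hz1, hz2⟩
      rw [← h.fim] at h1
      obtain ⟨w, hw, hwz⟩ := h1
      exact ⟨refl w, refl_mem.2 hw, by simp only [refl_refl, hwz]⟩
  flim := by
    have h1 := (refl_cont.tendsto 0).comp (h.flim.comp refl_tendsto)
    have h0 : refl 0 = 0 := by simp [refl]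
    rw [h0] at h1
    refine h1.congr fun z => ?_
    simp only [comp_apply]
    rw [← refl_sub, refl_refl]
  gdef := rfl

lemma reflect_hcap {a : ℝ} (ha : HasHcap K f a) :
    HasHcap (refl ⁻¹' K) (fun w => refl (f (refl w))) a := by
  have h1 := (continuous_conj.tendsto _).comp (Tendsto.comp ha refl_tendsto)
  rw [conj_ofReal] at h1
  refine h1.congr fun z => ?_
  simp only [comp_apply, refl, map_mul, map_sub, map_neg, conj_conj]
  ring

lemma reflect_holder {β C₀ : ℝ} (hH : IsHolder f β C₀) :
    IsHolder (fun w => refl (f (refl w))) β C₀ := by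
  intro z hz w hw
  have := hH _ (refl_mem.2 hz) _ (refl_mem.2 hw)
  rw [refl_dist] at this
  simpa [refl_dist] using this

end Hyd

open Hyd MeasureTheory

theorem holder_slit_diam_bound (β C₀ : ℝ) (hβ0 : 0 < β) (hβ1 : β ≤ 1) (hC₀ : 0 < C₀) :
    ∃ C > 0, ∀ (γ : ℝ → ℂ) (K : Set ℂ) (f : ℂ → ℂ) (a : ℝ),
      ContinuousOn γ (Icc 0 1) → InjOn γ (Icc 0 1) →
      (γ 0).im = 0 → (∀ t ∈ Ioc (0:ℝ) 1, γ t ∈ UHP) →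
      K = γ '' Ioc 0 1 →
      IsHull K → IsHydroMap K f → HasHcap K f a →
      IsHolder f β C₀ →
      Metric.diam K ≤ C * Real.sqrt (a * (1 + posLog (1 / Metric.diam K))) := by
  obtain ⟨C1, hC1, hone⟩ := one_sided hβ0 hβ1 hC₀
  refine ⟨Real.sqrt (128 * C1), by positivity, ?_⟩
  intro γ K f a hγc _ hγ0 hγU hKd hhull hf ha hH
  have h : Hyd K f (invFunOn f UHP) :=
    ⟨hhull.2.1, hhull.2.2.1, hf.1, hf.2.1, hf.2.2.1, hf.2.2.2, rfl⟩
  have ha0 := h.hcap_nonneg ha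
  set D := Metric.diam K with hD
  rcases (Metric.diam_nonneg (s := K)).eq_or_lt with hD0 | hD0
  · rw [← hD] at hD0; rw [← hD0]; positivity
  rw [← hD] at hD0
  set x₀ := (γ 0).re with hx₀
  have hx : γ 0 = (x₀ : ℂ) := Complex.ext (by simp [hx₀]) (by simp [hγ0])
  have hins : insert (x₀:ℂ) K = γ '' Icc 0 1 := by
    rw [← hx, hKd, ← image_insert_eq, Ioc_insert_left zero_le_one]
  have hcomp : IsCompact (insert (x₀:ℂ) K) := by
    rw [hins]; exact isCompact_Icc.image_of_continuousOn hγc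
  have hnc : ContinuousOn (fun t => ‖γ t - x₀‖) (Icc 0 1) := (hγc.sub continuousOn_const).norm
  obtain ⟨t1, ht1, hmax⟩ := isCompact_Icc.exists_isMaxOn (nonempty_Icc.2 zero_le_one) hnc
  set ρ := ‖γ t1 - x₀‖ with hρd
  have hmax' : ∀ t ∈ Icc (0:ℝ) 1, ‖γ t - x₀‖ ≤ ρ := fun t ht => hmax ht
  have hρ : 0 < ρ := by
    refine lt_of_lt_of_le ?_ (hmax' 1 (right_mem_Icc.2 zero_le_one))
    rw [norm_pos_iff]
    intro h0
    have h1 : 0 < (γ 1).im := hγU 1 (right_mem_Ioc.2 zero_lt_one)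
    have h2 := congrArg Complex.im h0
    simp at h2
    linarith
  have hKb : K ⊆ closedBall (x₀ : ℂ) ρ := by
    rw [hKd]
    rintro _ ⟨t, ht, rfl⟩
    rw [mem_closedBall, dist_eq_norm]
    exact hmax' t (Ioc_subset_Icc_self ht)
  have hDρ : D ≤ 2 * ρ := by
    refine (Metric.diam_mono hKb isBounded_closedBall).trans (Metric.diam_closedBall hρ.le)
  have h1 := hone K f _ x₀ ρ a h hρ hKb hcomp.isClosed ha hH
  have h2 := hone _ _ _ (-x₀) ρ a h.reflect hρ
    (by
      intro z hz
      have := hKb hz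
      rw [mem_closedBall] at this ⊢
      rw [← refl_dist, refl_ofReal, neg_neg]; exact this)
    (by
      have : insert ((-x₀ : ℝ) : ℂ) (refl ⁻¹' K) = refl ⁻¹' (insert (x₀:ℂ) K) := by
        ext z
        simp only [mem_insert_iff, mem_preimage]
        refine or_congr ⟨fun h => ?_, fun h => ?_⟩ Iff.rfl
        · rw [h, refl_ofReal, neg_neg]
        · rw [← refl_refl z, h, refl_ofReal]
      rw [this]; exact hcomp.isClosed.preimage refl_cont)
    (reflect_hcap ha) (reflect_holder hH)
  set v := volume.real (hitR K x₀ ρ) with hv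
  set v' := volume.real (hitR (refl ⁻¹' K) (-x₀) ρ) with hv'
  set X := a * (1 + posLog (1 / ρ)) with hX
  have hcover : Ioo (ρ / 2) ρ ⊆ hitR K x₀ ρ ∪ hitR (refl ⁻¹' K) (-x₀) ρ := by
    intro s hs
    have hs0 : 0 < s := by linarith [hs.1]
    have hivt := intermediate_value_Icc ht1.1 (hnc.mono (Icc_subset_Icc_right ht1.2))
    obtain ⟨t, ht, hts⟩ := hivt (show s ∈ Icc ‖γ 0 - x₀‖ ‖γ t1 - x₀‖ by
      rw [hx, sub_self, norm_zero]; exact ⟨hs0.le, hs.2.le⟩)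
    simp only at hts
    have ht0 : t ≠ 0 := by
      rintro rfl
      rw [hx, sub_self, norm_zero] at hts; linarith
    have htK : γ t ∈ K := by
      rw [hKd]
      exact ⟨t, ⟨lt_of_le_of_ne ht.1 (Ne.symm ht0), ht.2.trans ht1.2⟩, rfl⟩
    rcases le_total x₀ (γ t).re with hle | hle
    · left; exact ⟨hs, γ t, htK, hts, hle⟩
    · right
      refine ⟨hs, refl (γ t), by simpa [refl_refl] using htK, ?_, by simpa [Hyd.refl] using hle⟩
      rw [← refl_ofReal, refl_sub, refl_norm, hts]
  have hsum : ρ / 2 ≤ v + v' := by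
    have hfin : volume (hitR K x₀ ρ ∪ hitR (refl ⁻¹' K) (-x₀) ρ) ≠ ⊤ := by
      refine ne_top_of_le_ne_top (b := volume (Ioo (ρ/2) ρ)) (by simp) (measure_mono ?_)
      rintro s (hs | hs)
      · exact hs.1
      · exact hs.1
    have h3 := (measureReal_mono hcover hfin).trans (measureReal_union_le _ _)
    rw [Real.volume_real_Ioo_of_le (by linarith)] at h3
    linarith
  have hpl : posLog (1 / ρ) ≤ 1 + posLog (1 / D) := by
    unfold posLog
    refine max_le ?_ (by positivity)
    have h3 : Real.log (1 / ρ) ≤ Real.log (2 * (1 / D)) := by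
      apply Real.log_le_log (by positivity)
      rw [mul_one_div, div_le_div_iff₀ hρ hD0]; linarith
    rw [Real.log_mul two_ne_zero (by positivity)] at h3
    have := Real.log_two_lt_d9
    have := le_max_left (Real.log (1 / D)) 0
    linarith
  have hPD := posLog_nonneg (1 / D)
  have hXY : X ≤ 2 * (a * (1 + posLog (1 / D))) := by
    rw [hX]; nlinarith
  have hD2 : D ^ 2 ≤ 128 * C1 * (a * (1 + posLog (1 / D))) := by
    have e1 : D ^ 2 ≤ (4 * (v + v')) ^ 2 := pow_le_pow_left₀ hD0.le (by linarith) 2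
    have e2 : C1 * X ≤ C1 * (2 * (a * (1 + posLog (1 / D)))) := by gcongr
    nlinarith [sq_nonneg (v - v')]
  rw [← Real.sqrt_mul (by positivity)]
  exact Real.le_sqrt_of_sq_le hD2
end
end

section
/- Let D̄ = {z ∈ ℂ : |z| ≤ 1} be the closed unit disk, let A ⊂ D̄ be closed, and let x, y ∈ D̄ \ A be points that lie in different path components of D̄ \ A (i.e., there is no continuous path in D̄ \ A from x to y). Then there is a connected component C of A such that x and y lie in different path components of D̄ \ C. -/
open Set Metric Filter Bornology Complex Function

noncomputable section

lemma lift_const {X : Type*} [TopologicalSpace X] {S : Set X} {h g : X → ℝ}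
    (hh : ContinuousOn h S) (hg : Continuous g)
    (hgh : ∀ z ∈ S, ((h z : ℝ) : AddCircle (1:ℝ)) = ((g z : ℝ) : AddCircle (1:ℝ)))
    {x y : X} (hxy : JoinedIn S x y) : g y - h y = g x - h x := by
  obtain ⟨γ, hγ⟩ := hxy
  have h1 : Continuous fun t => h (γ t) :=
    hh.comp_continuous γ.continuous hγ
  have h2 : Continuous fun t => g (γ t) := hg.comp γ.continuous
  have hx : x ∈ S := by simpa using hγ 0
  have := (AddCircle.isCoveringMap_coe (1:ℝ)).eq_of_comp_eq
    (g₁ := fun t => h (γ t) + (g x - h x)) (g₂ := fun t => g (γ t))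
    (h1.add continuous_const) h2 (by
      funext t
      simp only [Function.comp]
      rw [AddCircle.coe_add, AddCircle.coe_sub, hgh _ (hγ t), hgh _ hx]; simp) 0 (by simp)
  have := congrFun this 1
  simp at this
  linarith

lemma frontier_comp {X : Type*} [TopologicalSpace X] [LocallyPathConnectedSpace X] {F : Set X}
    (hF : IsOpen F) (x : X) : ∀ z ∈ frontier (pathComponentIn F x), z ∉ F := by
  intro z hz hzF
  have hP := hF.pathComponentIn x
  rw [hP.frontier_eq] at hz
  obtain ⟨w, hw1, hw2⟩ := mem_closure_iff.1 hz.1 _ (hF.pathComponentIn z)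
    (mem_pathComponentIn_self hzF)
  exact hz.2 (JoinedIn.trans hw2 (JoinedIn.symm hw1))

lemma two_sets {X : Type*} [TopologicalSpace X] [LocallyPathConnectedSpace X]
    [SimplyConnectedSpace X] [NormalSpace X] {B₁ B₂ : Set X} (h₁ : IsClosed B₁)
    (h₂ : IsClosed B₂) (hd : Disjoint B₁ B₂) {x y : X}
    (j₁ : JoinedIn B₁ᶜ x y) (j₂ : JoinedIn B₂ᶜ x y) : JoinedIn (B₁ ∪ B₂)ᶜ x y := by
  classical
  by_contra hn
  obtain ⟨u, hu1, hu2, -⟩ := exists_continuous_zero_one_of_isClosed h₁ h₂ hd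
  have hFo : IsOpen (B₁ ∪ B₂)ᶜ := (h₁.union h₂).isOpen_compl
  have hx : x ∈ (B₁ ∪ B₂)ᶜ := by
    have := j₁.source_mem; have := j₂.source_mem; simp_all
  set P := pathComponentIn (B₁ ∪ B₂)ᶜ x with hP
  have hxP : x ∈ P := mem_pathComponentIn_self hx
  have hyP : y ∉ P := hn
  have hPF : P ⊆ (B₁ ∪ B₂)ᶜ := pathComponentIn_subset
  have hfr : ∀ z ∈ frontier P, z ∈ B₁ ∨ z ∈ B₂ := fun z hz => by
    have := frontier_comp hFo x z hz
    exact not_notMem.1 this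
  let f : X → AddCircle (1:ℝ) := fun z => if z ∈ P then ((u z : ℝ) : AddCircle (1:ℝ)) else 0
  have hone : ((1:ℝ) : AddCircle (1:ℝ)) = 0 := AddCircle.coe_period 1
  have hf : Continuous f := by
    refine Continuous.if ?_ ((AddCircle.continuous_mk' 1).comp u.continuous) continuous_const
    intro z hz
    rcases hfr z hz with h | h
    · rw [hu1 h]; simp
    · rw [hu2 h]; simpa using hone
  obtain ⟨g, ⟨-, hg⟩, -⟩ := (AddCircle.isCoveringMap_coe (1:ℝ)).existsUnique_continuousMap_lifts
    ⟨f, hf⟩ x (u x) (by simp [f, hxP])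
  have hg' : ∀ z, ((g z : ℝ) : AddCircle (1:ℝ)) = f z := fun z => congrFun hg z
  have e1 := lift_const (S := B₁ᶜ) (h := fun z => if z ∈ P then u z else 1) (g := g) (by
      refine ContinuousOn.if ?_ u.continuous.continuousOn continuousOn_const
      intro z hz
      rcases hfr z hz.2 with h | h
      · exact absurd h hz.1
      · exact hu2 h) g.continuous (by
      intro z _
      rw [hg']
      by_cases hz : z ∈ P <;> simp [f, hz, hone]) j₁
  have e2 := lift_const (S := B₂ᶜ) (h := fun z => if z ∈ P then u z else 0) (g := g) (by
      refine ContinuousOn.if ?_ u.continuous.continuousOn continuousOn_const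
      intro z hz
      rcases hfr z hz.2 with h | h
      · exact hu1 h
      · exact absurd h hz.1) g.continuous (by
      intro z _
      rw [hg']
      by_cases hz : z ∈ P <;> simp [f, hz]) j₂
  simp only [hxP, hyP, if_true, if_false] at e1 e2
  linarith

lemma exists_connected_sep {X : Type*} [TopologicalSpace X] [LocallyPathConnectedSpace X]
    [SimplyConnectedSpace X] [NormalSpace X] {A : Set X} (hA : IsClosed A) {x y : X}
    (hsep : ¬ JoinedIn Aᶜ x y) :
    ∃ B ⊆ A, IsConnected B ∧ ¬ JoinedIn Bᶜ x y := by
  obtain ⟨B, hBA, hB⟩ := zorn_superset_nonempty {B : Set X | IsClosed B ∧ ¬ JoinedIn Bᶜ x y} (by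
    intro c hc hch hne
    refine ⟨⋂₀ c, ⟨isClosed_sInter fun s hs => (hc hs).1, ?_⟩, fun s hs => sInter_subset_of_mem hs⟩
    rintro ⟨γ, hγ⟩
    have hcomp : IsCompact (range γ) := isCompact_range γ.continuous
    have : ∃ s ∈ c, Disjoint (range γ) s := by
      by_contra! hcon
      haveI : Nonempty c := hne.to_subtype
      have hne' : (range γ ∩ ⋂ s : c, (s : Set X)).Nonempty := by
        refine hcomp.inter_iInter_nonempty _ (fun s => (hc s.2).1) ?_
        intro t
        have hdir : Directed (· ⊇ ·) (fun s : c => (s : Set X)) := by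
          intro a b
          rcases hch.total a.2 b.2 with h | h
          · exact ⟨a, Subset.rfl, h⟩
          · exact ⟨b, h, Subset.rfl⟩
        obtain ⟨m, hm⟩ := hdir.finset_le t
        obtain ⟨z, hz⟩ := not_disjoint_iff_nonempty_inter.1 (hcon m m.2)
        exact ⟨z, hz.1, mem_iInter₂.2 fun i hi => hm i hi hz.2⟩
      obtain ⟨z, ⟨t, rfl⟩, hz⟩ := hne'
      exact hγ t (by rwa [sInter_eq_iInter])
    obtain ⟨s, hs, hd⟩ := this
    exact (hc hs).2 ⟨γ, fun t ht => hd.le_bot ⟨mem_range_self t, ht⟩⟩) A ⟨hA, hsep⟩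
  obtain ⟨⟨hBc, hBs⟩, hmin⟩ := hB
  refine ⟨B, hBA, ⟨?_, ?_⟩, hBs⟩
  · rw [nonempty_iff_ne_empty]
    rintro rfl
    apply hBs
    rw [compl_empty, joinedIn_univ]
    exact PathConnectedSpace.joined x y
  · rw [isPreconnected_closed_iff]
    intro t t' ht ht' hsub hne hne'
    by_contra hcon
    have hd : Disjoint (B ∩ t) (B ∩ t') := by
      rw [disjoint_iff_inter_eq_empty, ← not_nonempty_iff_eq_empty]
      rintro ⟨z, hz, hz'⟩
      exact hcon ⟨z, hz.1, hz.2, hz'.2⟩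
    have hun : B ∩ t ∪ B ∩ t' = B := by
      rw [← inter_union_distrib_left]; exact inter_eq_left.2 hsub
    refine hBs (hun ▸ two_sets (hBc.inter ht) (hBc.inter ht') hd ?_ ?_)
    · by_contra hj
      have := hmin ⟨hBc.inter ht, hj⟩ inter_subset_left
      obtain ⟨z, hz, hz'⟩ := hne'
      exact hcon ⟨z, hz, (this hz).2, hz'⟩
    · by_contra hj
      have := hmin ⟨hBc.inter ht', hj⟩ inter_subset_left
      obtain ⟨z, hz, hz'⟩ := hne
      exact hcon ⟨z, hz, hz', (this hz).2⟩

/-- **Janiszewski's lemma.** If a closed set `A ⊆ D̄` separates `x` and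
`y` in the closed unit disk, then some connected component of `A` already separates
them. -/
theorem janiszewski (A : Set ℂ) (x y : ℂ) (hA : IsClosed A)
    (hAsub : A ⊆ Metric.closedBall 0 1)
    (hx : x ∈ Metric.closedBall (0:ℂ) 1 \ A) (hy : y ∈ Metric.closedBall (0:ℂ) 1 \ A)
    (hsep : ¬ JoinedIn (Metric.closedBall (0:ℂ) 1 \ A) x y) :
    ∃ c ∈ A, ¬ JoinedIn (Metric.closedBall (0:ℂ) 1 \ connectedComponentIn A c) x y := by
  have hconv : Convex ℝ (Metric.closedBall (0:ℂ) 1) := convex_closedBall _ _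
  haveI : LocallyPathConnectedSpace (Metric.closedBall (0:ℂ) 1) :=
    hconv.locallyPathConnectedSpace
  haveI : ContractibleSpace (Metric.closedBall (0:ℂ) 1) :=
    hconv.contractibleSpace ⟨x, hx.1⟩
  have key : ∀ S : Set ℂ, x ∉ S → y ∉ S →
      (JoinedIn (Metric.closedBall (0:ℂ) 1 \ S) x y ↔
        JoinedIn (((↑) : Metric.closedBall (0:ℂ) 1 → ℂ) ⁻¹' S)ᶜ ⟨x, hx.1⟩ ⟨y, hy.1⟩) := by
    intro S hxS hyS
    rw [← Topology.IsInducing.subtypeVal.joinedIn_image hxS hyS, ← preimage_compl,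
      Subtype.image_preimage_coe, diff_eq]
  rw [key A hx.2 hy.2] at hsep
  obtain ⟨B, hBA, hBc, hBs⟩ :=
    exists_connected_sep (hA.preimage continuous_subtype_val) hsep
  obtain ⟨b, hb⟩ := hBc.nonempty
  refine ⟨b, hBA hb, ?_⟩
  rw [key _ (fun h => hx.2 (connectedComponentIn_subset _ _ h))
    (fun h => hy.2 (connectedComponentIn_subset _ _ h))]
  refine fun h => hBs (h.mono (compl_subset_compl.2 ?_))
  rw [← image_subset_iff]
  exact (hBc.isPreconnected.image _ continuous_subtype_val.continuousOn).subset_connectedComponentIn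
    (mem_image_of_mem _ hb) (image_subset_iff.2 hBA)
end
end

section
/- Let z ∈ ℍ and let ℓ = {iy : y > 0} be the positive imaginary axis. Then log⁺(|Re(z)|/Im(z)) − 2 ≤ ρ_ℍ(z,ℓ) ≤ log⁺(|Re(z)|/Im(z)) + 2, where ρ_ℍ(z,ℓ) = inf{ρ_ℍ(z,w) : w ∈ ℓ}. -/
open Set Metric Filter Bornology Complex Function

noncomputable section

/-- The hyperbolic distance in `ℍ` from `z` to the positive imaginary axis. -/
def rhoToAxis (z : ℂ) : ℝ :=
  sInf {d : ℝ | ∃ y : ℝ, 0 < y ∧ d = rhoH z (y * Complex.I)}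

lemma cosh_rhoH_aux (z : ℂ) (hz : 0 < z.im) (y : ℝ) (hy : 0 < y) :
    Real.cosh (rhoH z (y * Complex.I)) = (z.re ^ 2 + z.im ^ 2 + y ^ 2) / (2 * z.im * y) := by
  have hd : dist z (y * Complex.I) ^ 2 = z.re ^ 2 + (z.im - y) ^ 2 := by
    rw [Complex.dist_eq, ← Complex.normSq_eq_norm_sq, Complex.normSq_apply]
    simp
    ring
  have hs : Real.sqrt (z.im * y) ^ 2 = z.im * y := Real.sq_sqrt (by positivity)
  unfold rhoH
  rw [Real.cosh_two_mul, Real.cosh_sq, Real.sinh_arsinh]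
  simp only [Complex.mul_im, Complex.ofReal_re, Complex.ofReal_im, Complex.I_im, Complex.I_re,
    mul_one, mul_zero, add_zero, zero_mul]
  rw [div_pow, mul_pow, hs, hd]
  field_simp
  ring

lemma rhoH_nonneg_aux (z w : ℂ) : 0 ≤ rhoH z w := by
  unfold rhoH
  have : 0 ≤ Real.arsinh (dist z w / (2 * Real.sqrt (z.im * w.im))) :=
    Real.arsinh_nonneg_iff.2 (by positivity)
  linarith

lemma max_le_exp_posLog (t : ℝ) (ht : 0 ≤ t) : t ≤ Real.exp (posLog t) := by
  rcases ht.eq_or_lt with h | h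
  · rw [← h]; positivity
  · calc t = Real.exp (Real.log t) := (Real.exp_log h).symm
      _ ≤ _ := Real.exp_le_exp.2 (le_max_left _ _)

/-- **Lemma `Hy`.** The hyperbolic distance from `z ∈ ℍ` to the
imaginary axis is `log⁺(|Re z| / Im z)` up to an additive error `2`. -/
theorem hyperbolic_dist_to_axis (z : ℂ) (hz : z ∈ UHP) :
    posLog (|z.re| / z.im) - 2 ≤ rhoToAxis z ∧
      rhoToAxis z ≤ posLog (|z.re| / z.im) + 2 := by
  have hv : 0 < z.im := hz
  constructor
  · refine le_csInf ⟨_, 1, one_pos, rfl⟩ ?_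
    rintro d ⟨y, hy, rfl⟩
    have h0 := rhoH_nonneg_aux z (y * Complex.I)
    have hc := cosh_rhoH_aux z hv y hy
    have hp : posLog (|z.re| / z.im) ≤ rhoH z (y * Complex.I) := by
      refine max_le ?_ h0
      rcases (div_nonneg (abs_nonneg z.re) hv.le).eq_or_lt with h | h
      · rw [← h, Real.log_zero]; exact h0
      · rw [Real.log_le_iff_le_exp h]
        have h1 : |z.re| / z.im ≤ Real.cosh (rhoH z (y * Complex.I)) := by
          rw [hc, div_le_div_iff₀ hv (by positivity)]
          have : 0 ≤ z.im * ((|z.re| - y) ^ 2 + z.im ^ 2) := by positivity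
          nlinarith [sq_abs z.re]
        have h2 : Real.exp (-rhoH z (y * Complex.I)) ≤ Real.exp (rhoH z (y * Complex.I)) :=
          Real.exp_le_exp.2 (by linarith)
        rw [Real.cosh_eq] at h1
        linarith
    linarith
  · set y : ℝ := Real.sqrt (z.re ^ 2 + z.im ^ 2) with hy
    have hypos : 0 < y := Real.sqrt_pos.2 (by positivity)
    have hsq : y ^ 2 = z.re ^ 2 + z.im ^ 2 := Real.sq_sqrt (by positivity)
    have hle : rhoToAxis z ≤ rhoH z (y * Complex.I) := by
      refine csInf_le ⟨0, ?_⟩ ⟨y, hypos, rfl⟩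
      rintro d ⟨y, hy, rfl⟩
      exact rhoH_nonneg_aux _ _
    refine hle.trans ?_
    have hc := cosh_rhoH_aux z hv y hypos
    have hc2 : Real.cosh (rhoH z (y * Complex.I)) = y / z.im := by
      rw [hc, ← hsq]; field_simp; ring
    have hyle : y ≤ |z.re| + z.im := by
      refine Real.sqrt_le_iff.2 ⟨by positivity, ?_⟩
      nlinarith [sq_abs z.re, mul_nonneg (abs_nonneg z.re) hv.le]
    have h1 : y / z.im ≤ |z.re| / z.im + 1 := by
      rw [div_add_one hv.ne']; gcongr
    have h2 := max_le_exp_posLog (|z.re| / z.im) (by positivity)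
    have h3 : 1 ≤ Real.exp (posLog (|z.re| / z.im)) := Real.one_le_exp (le_max_right _ _)
    have h4 : (4 : ℝ) ≤ Real.exp 2 := by
      have : Real.exp 2 = Real.exp 1 * Real.exp 1 := by rw [← Real.exp_add]; norm_num
      nlinarith [Real.exp_one_gt_d9]
    rw [← Real.exp_le_exp, Real.exp_add]
    have h5 := Real.exp_pos (-rhoH z (y * Complex.I))
    rw [Real.cosh_eq] at hc2
    nlinarith
end
end
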